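/- Let T be a symmetric interval exchange transformation on I = [0,1) that is ergodic with respect to Lebesgue measure, and let f(x) = a(x - 1/2) for some real a ≠ 0. Then the skew product T_f : I × ℝ → I × ℝ, T_f(x,r) = (T(x), r + f(x)), is ergodic with respect to the product measure λ_I ⊗ λ_ℝ of Lebesgue measure on I and Lebesgue measure on ℝ. -/

import Mathlib

open MeasureTheory Set
open scoped Classical

/-- An interval exchange transformation (IET) on the interval `[a, b)`:
an alphabet `Fin d`, bijections `perm0`, `perm1 : Fin d ≃ Fin d` describing the order of
the exchanged intervals before and after applying the map, and a positive length vector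
`len` summing up to `b - a`.  The permutation datum is assumed non-reducible. -/
structure IET where
  d : ℕ
  hd : 0 < d
  a : ℝ
  b : ℝ
  hab : a < b
  perm0 : Fin d ≃ Fin d
  perm1 : Fin d ≃ Fin d
  len : Fin d → ℝ
  len_pos : ∀ α, 0 < len α
  len_sum : ∑ α, len α = b - a
  irred : ∀ k : ℕ, 0 < k → k < d → ¬ (∀ α, (perm0 α : ℕ) < k ↔ (perm1 α : ℕ) < k)

namespace IET

variable (T : IET)

/-- The left endpoint `∂I_α` of the exchanged interval `I_α`. -/
noncomputable def lep (α : Fin T.d) : ℝ :=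
  T.a + ∑ β ∈ Finset.univ.filter (fun β => T.perm0 β < T.perm0 α), T.len β

/-- The left endpoint of the image interval `T(I_α)`. -/
noncomputable def lepImg (α : Fin T.d) : ℝ :=
  T.a + ∑ β ∈ Finset.univ.filter (fun β => T.perm1 β < T.perm1 α), T.len β

/-- The translation amount on `I_α`. -/
noncomputable def transl (α : Fin T.d) : ℝ := T.lepImg α - T.lep α

/-- The exchanged interval `I_α`. -/
noncomputable def interval (α : Fin T.d) : Set ℝ :=
  Set.Ico (T.lep α) (T.lep α + T.len α)

/-- The image interval `T(I_α)`. -/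
noncomputable def intervalImg (α : Fin T.d) : Set ℝ :=
  Set.Ico (T.lepImg α) (T.lepImg α + T.len α)

/-- The IET as a self-map of `ℝ`: it translates each `I_α` onto its image and is
the identity outside `[a, b)`. -/
noncomputable def toFun (x : ℝ) : ℝ :=
  x + ∑ α, if x ∈ T.interval α then T.transl α else 0

/-- The inverse IET `T⁻¹` as a self-map of `ℝ`. -/
noncomputable def invFun (x : ℝ) : ℝ :=
  x + ∑ α, if x ∈ T.intervalImg α then -T.transl α else 0

/-- The iterate `T^n`, `n : ℤ` (negative iterates via `invFun`). -/
noncomputable def iter (n : ℤ) (x : ℝ) : ℝ :=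
  if 0 ≤ n then T.toFun^[n.toNat] x else T.invFun^[(-n).toNat] x

/-- `M(β) = min {n ≥ 1 | T^{-n}(∂I_β) = ∂I_α for some α with π₁ α ≠ 1}`, with the
convention `M(π₀⁻¹ 1) = 1`, and `∞` if no such `n` exists. -/
noncomputable def M (β : Fin T.d) : ℕ∞ :=
  if (T.perm0 β : ℕ) = 0 then 1
  else sInf {e : ℕ∞ | ∃ n : ℕ, e = (n : ℕ∞) ∧ 1 ≤ n ∧
    ∃ α : Fin T.d, (T.perm1 α : ℕ) ≠ 0 ∧ T.invFun^[n] (T.lep β) = T.lep α}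

/-- `N(β) = min {n ≥ 1 | T^{n}(∂I_β) = ∂I_α for some α with π₀ α ≠ 1}`, with the
convention `N(π₁⁻¹ 1) = 1`, and `∞` if no such `n` exists. -/
noncomputable def N (β : Fin T.d) : ℕ∞ :=
  if (T.perm1 β : ℕ) = 0 then 1
  else sInf {e : ℕ∞ | ∃ n : ℕ, e = (n : ℕ∞) ∧ 1 ≤ n ∧
    ∃ α : Fin T.d, (T.perm0 α : ℕ) ≠ 0 ∧ T.toFun^[n] (T.lep β) = T.lep α}

/-- `s` is a (non-trivial) connection of `T`: the orbit segment
`{T^{-k}(∂I_β) | 0 ≤ k ≤ n}` where `π₀ β ≠ 1`, `π₁ α ≠ 1`, `n ≥ 1` and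
`T^{-n}(∂I_β) = ∂I_α`. -/
def IsConnection (s : Set ℝ) : Prop :=
  ∃ (β α : Fin T.d) (n : ℕ), (T.perm0 β : ℕ) ≠ 0 ∧ (T.perm1 α : ℕ) ≠ 0 ∧ 1 ≤ n ∧
    T.invFun^[n] (T.lep β) = T.lep α ∧
    s = (fun k : ℕ => T.invFun^[k] (T.lep β)) '' {k : ℕ | k ≤ n}

/-- `T` is symmetric: `π₁ ∘ π₀⁻¹ (i) = d + 1 - i` (here with `Fin d` indexing:
`perm1 α + perm0 α + 1 = d`). -/
def IsSymm : Prop := ∀ α, (T.perm1 α : ℕ) + (T.perm0 α : ℕ) + 1 = T.d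

/-- The midpoint `c_α` of the exchanged interval `I_α`. -/
noncomputable def center (α : Fin T.d) : ℝ := T.lep α + T.len α / 2

/-- The midpoint `c_{1/2}` of the interval `I = [a, b)`. -/
noncomputable def centerHalf : ℝ := (T.a + T.b) / 2

/-- Midpoints indexed by `𝒜 ∪ {1/2}`; `none` plays the role of `1/2`. -/
noncomputable def centerOpt (β : Option (Fin T.d)) : ℝ :=
  match β with
  | none => T.centerHalf
  | some α => T.center α

/-- `δ_{1/2}`. -/
def deltaHalf (β : Option (Fin T.d)) : ℕ :=
  match β with
  | none => 1
  | some _ => 0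

/-- The symmetric reflection `𝓘_I (x) = a + b - x` of `I = [a, b)`. -/
noncomputable def refl (x : ℝ) : ℝ := T.a + T.b - x

/-- The first return time `r_J(x) = min {n ≥ 1 | T^n x ∈ J}`. -/
noncomputable def returnTime (J : Set ℝ) (x : ℝ) : ℕ :=
  sInf {n : ℕ | 1 ≤ n ∧ T.toFun^[n] x ∈ J}

/-- The first return map `T_J`. -/
noncomputable def firstReturn (J : Set ℝ) (x : ℝ) : ℝ := T.toFun^[T.returnTime J x] x

/-- The first backward return time `b_J(x) = min {n ≥ 1 | T^{-n} x ∈ J}`. -/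
noncomputable def backTime (J : Set ℝ) (x : ℝ) : ℕ :=
  sInf {n : ℕ | 1 ≤ n ∧ T.invFun^[n] x ∈ J}

/-- The first backward return map `p_J` (the inverse of the first return map `T_J`). -/
noncomputable def backReturn (J : Set ℝ) (x : ℝ) : ℝ := T.invFun^[T.backTime J x] x

/-- `m_{J,α} = inf {n ≥ 0 | T^{-n}(∂I_α) ∈ interior J}`. -/
noncomputable def mJ (J : Set ℝ) (α : Fin T.d) : ℕ :=
  sInf {n : ℕ | T.invFun^[n] (T.lep α) ∈ interior J}

/-- `J` is of form (★): a subinterval `[a_J, b_J) ⊆ I` whose endpoints are iterates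
`T^{m₀}(∂I_{α_J})`, `T^{n₀}(∂I_{β_J})` of left endpoints which do not visit `J` at any
earlier time between `0` and `m₀` (resp. `n₀`). -/
def IsStarForm (J : Set ℝ) : Prop :=
  ∃ (aJ bJ : ℝ) (αJ βJ : Fin T.d) (m₀ n₀ : ℤ),
    aJ < bJ ∧ J = Set.Ico aJ bJ ∧ J ⊆ Set.Ico T.a T.b ∧
    aJ = T.iter m₀ (T.lep αJ) ∧ bJ = T.iter n₀ (T.lep βJ) ∧
    (∀ m : ℤ, (0 ≤ m ∧ m ≤ m₀ ∨ m₀ ≤ m ∧ m ≤ 0) → m ≠ m₀ → T.iter m (T.lep αJ) ∉ J) ∧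
    (∀ n : ℤ, (0 ≤ n ∧ n ≤ n₀ ∨ n₀ ≤ n ∧ n ≤ 0) → n ≠ n₀ → T.iter n (T.lep βJ) ∉ J)

/-- `J` is a `β`-symmetric interval (`β : Option (Fin T.d)`, `none` = `1/2`-symmetric):
`J = [c_β - Δ, c_β + Δ)` with `Δ > 0`, contained in `I_β` (resp. in `I`). -/
def IsSymmetricInterval (J : Set ℝ) (β : Option (Fin T.d)) : Prop :=
  ∃ Δ : ℝ, 0 < Δ ∧ J = Set.Ico (T.centerOpt β - Δ) (T.centerOpt β + Δ) ∧
    (match β with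
      | some γ => J ⊆ T.interval γ
      | none => J ⊆ Set.Ico T.a T.b)

/-- `x` is a left endpoint of one of the intervals exchanged by the first return map
`T_J`, where `J = [aJ, bJ)`: either `x = aJ`, or the forward orbit of `x` before its
first return to `J` meets a left endpoint `∂I_α` of `T` or the right endpoint `bJ`. -/
def IsExchLeftEndpoint (J : Set ℝ) (aJ bJ : ℝ) (x : ℝ) : Prop :=
  x = aJ ∨ ∃ k : ℕ, k < T.returnTime J x ∧
    ((∃ α : Fin T.d, T.toFun^[k] x = T.lep α) ∨ (1 ≤ k ∧ T.toFun^[k] x = bJ))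

/-- A Rokhlin tower decomposition of `I = [a, b)` over `J = [aJ, bJ)` associated with the
first return map `T_J`: the bases `[base γ, base γ + blen γ)` partition `J`, the return
time on the base `γ` is constantly `h γ`, each `T^i` (`i ≤ h γ`) acts as a translation on
the base `γ`, and the tower levels `T^i([base γ, base γ + blen γ))`, `i < h γ`, are
pairwise disjoint and partition `I`. -/
def IsTowerDecomp (aJ bJ : ℝ) {k : ℕ} (base blen : Fin k → ℝ) (h : Fin k → ℕ) : Prop :=
  (∀ γ, 0 < blen γ) ∧ (∀ γ, 1 ≤ h γ) ∧
  Pairwise (Function.onFun Disjoint fun γ => Set.Ico (base γ) (base γ + blen γ)) ∧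
  (⋃ γ, Set.Ico (base γ) (base γ + blen γ)) = Set.Ico aJ bJ ∧
  (∀ γ, ∀ i ≤ h γ, ∀ x ∈ Set.Ico (base γ) (base γ + blen γ),
    T.toFun^[i] x - T.toFun^[i] (base γ) = x - base γ) ∧
  (∀ γ, ∀ x ∈ Set.Ico (base γ) (base γ + blen γ), T.returnTime (Set.Ico aJ bJ) x = h γ) ∧
  (⋃ γ, ⋃ i ∈ Finset.range (h γ), T.toFun^[i] '' Set.Ico (base γ) (base γ + blen γ))
    = Set.Ico T.a T.b ∧
  (∀ γ γ' : Fin k, ∀ i i' : ℕ, i < h γ → i' < h γ' → (γ, i) ≠ (γ', i') →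
    Disjoint (T.toFun^[i] '' Set.Ico (base γ) (base γ + blen γ))
      (T.toFun^[i'] '' Set.Ico (base γ') (base γ' + blen γ')))

/-- Replace the length data of an IET, keeping the combinatorial data. -/
noncomputable abbrev replaceLen (len' : Fin T.d → ℝ) (h1 : ∀ α, 0 < len' α)
    (h2 : ∑ α, len' α = T.b - T.a) : IET :=
  { T with len := len', len_pos := h1, len_sum := h2 }

end IET

/-- The properties of an ergodic symmetric interval exchange transformation of `[0, 1)` used in the
proof; `P` is the set of left endpoints of the exchanged intervals. -/
structure SymmIET (T : ℝ → ℝ) (P : Finset ℝ) : Prop where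
  erg : Ergodic T (volume.restrict (Ico (0 : ℝ) 1))
  mapsTo : MapsTo T (Ico 0 1) (Ico 0 1)
  injOn : InjOn T (Ico 0 1)
  zero_mem : 0 ∈ P
  translates : ∀ a b : ℝ, a < b → Ioo a b ⊆ Ico 0 1 → (∀ p ∈ P, p ∉ Ioo a b) →
    ∃ t, ∀ x ∈ Ioo a b, T x = x + t
  reflect : ∀ z ∈ Ico (0 : ℝ) 1, z ∉ P → T (1 - T z) = 1 - z
  exch : ∀ y ∈ Ico (0 : ℝ) 1, ∀ z ∈ Ico (0 : ℝ) 1, z ∉ P →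
    (if T y < T z then (1 : ℤ) else 0) - (if 1 - T z < y then 1 else 0) =
      (if y < z then 1 else 0) - (if 1 - T y < z then 1 else 0)

namespace IET

variable (T : IET)

lemma lep_add_len (α : Fin T.d) :
    T.lep α + T.len α =
      T.a + ∑ β ∈ Finset.univ.filter (fun β => T.perm0 β ≤ T.perm0 α), T.len β := by
  have : Finset.univ.filter (fun β => T.perm0 β ≤ T.perm0 α) =
      insert α (Finset.univ.filter (fun β => T.perm0 β < T.perm0 α)) := by
    ext β
    simp [le_iff_eq_or_lt]
  rw [this, Finset.sum_insert (by simp), lep]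
  ring

lemma lep_add_len_le_lep {α β : Fin T.d} (h : T.perm0 α < T.perm0 β) :
    T.lep α + T.len α ≤ T.lep β := by
  rw [lep_add_len, lep]
  gcongr
  · intro _ _ _
    exact (T.len_pos _).le

lemma a_le_lep (α : Fin T.d) : T.a ≤ T.lep α := by
  rw [lep]
  have : 0 ≤ ∑ β ∈ Finset.univ.filter (fun β => T.perm0 β < T.perm0 α), T.len β :=
    Finset.sum_nonneg fun _ _ => (T.len_pos _).le
  linarith

lemma lep_add_len_le (α : Fin T.d) : T.lep α + T.len α ≤ T.b := by
  have h : ∑ β ∈ Finset.univ.filter (fun β => T.perm0 β ≤ T.perm0 α), T.len β ≤ ∑ β, T.len β :=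
    Finset.sum_le_sum_of_subset_of_nonneg (Finset.filter_subset _ _)
      fun _ _ _ => (T.len_pos _).le
  rw [lep_add_len]
  linarith [T.len_sum]

lemma lepImg_of_isSymm (hs : T.IsSymm) (α : Fin T.d) :
    T.lepImg α = T.a + T.b - T.lep α - T.len α := by
  have h1 : Finset.univ.filter (fun β => T.perm1 β < T.perm1 α) =
      Finset.univ.filter (fun β => ¬ T.perm0 β ≤ T.perm0 α) := by
    ext β
    have := hs α
    have := hs β
    simp only [Finset.mem_filter, Finset.mem_univ, true_and, Fin.lt_def, Fin.le_def]
    omega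
  have h2 := Finset.sum_filter_add_sum_filter_not Finset.univ
    (fun β => T.perm0 β ≤ T.perm0 α) T.len
  have h3 := T.lep_add_len α
  rw [lepImg, h1]
  linarith [T.len_sum]

lemma exists_mem_interval {x : ℝ} (hx : x ∈ Ico T.a T.b) : ∃ α, x ∈ T.interval α := by
  have hne : (Finset.univ.filter (fun α => T.lep α ≤ x)).Nonempty := by
    refine ⟨T.perm0.symm ⟨0, T.hd⟩, ?_⟩
    have : Finset.univ.filter (fun β => T.perm0 β < ⟨0, T.hd⟩) = ∅ := by
      ext β
      simp [Fin.lt_def]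
    rw [Finset.mem_filter, lep, Equiv.apply_symm_apply, this]
    simpa using hx.1
  obtain ⟨α, hα, hmax⟩ := Finset.exists_max_image _ (fun α => (T.perm0 α : ℕ)) hne
  refine ⟨α, (Finset.mem_filter.1 hα).2, ?_⟩
  by_contra! hcon
  rw [lep_add_len] at hcon
  by_cases hlast : (T.perm0 α : ℕ) + 1 < T.d
  · have hle : T.lep (T.perm0.symm ⟨T.perm0 α + 1, hlast⟩) ≤ x := by
      refine le_trans (le_of_eq ?_) hcon
      rw [lep]
      congr 2
      ext β
      simp only [Equiv.apply_symm_apply, Finset.mem_filter, Finset.mem_univ, true_and,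
        Fin.lt_def, Fin.le_def]
      omega
    have := hmax _ (Finset.mem_filter.2 ⟨Finset.mem_univ _, hle⟩)
    simp at this
  · have : Finset.univ.filter (fun β => T.perm0 β ≤ T.perm0 α) = Finset.univ := by
      ext β
      have := (T.perm0 β).2
      simp only [Finset.mem_filter, Finset.mem_univ, true_and, Fin.le_def, iff_true]
      omega
    rw [this, T.len_sum] at hcon
    linarith [hx.2]

lemma toFun_of_mem_interval {x : ℝ} {α : Fin T.d} (hx : x ∈ T.interval α) :
    T.toFun x = x + T.transl α := by
  rw [toFun, Finset.sum_eq_single α]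
  · simp [hx]
  · intro β _ hβ
    refine if_neg fun hx' => ?_
    rcases lt_or_gt_of_ne (fun h => hβ (T.perm0.injective h)) with h | h
    · have := T.lep_add_len_le_lep h
      linarith [hx.1, hx'.2]
    · have := T.lep_add_len_le_lep h
      linarith [hx.2, hx'.1]
  · simp

theorem symmIET (ha0 : T.a = 0) (hb1 : T.b = 1) (hsymm : T.IsSymm)
    (hErg : Ergodic T.toFun (volume.restrict (Set.Ico (0 : ℝ) 1))) :
    SymmIET T.toFun (Finset.univ.image T.lep) := by
  have key : ∀ x ∈ Ico (0 : ℝ) 1, ∃ α, T.lep α ≤ x ∧ x < T.lep α + T.len α := by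
    intro x hx
    exact T.exists_mem_interval (by rwa [ha0, hb1])
  have val : ∀ x α, T.lep α ≤ x → x < T.lep α + T.len α →
      T.toFun x = 1 - (2 * T.lep α + T.len α - x) := by
    intro x α h1 h2
    rw [T.toFun_of_mem_interval ⟨h1, h2⟩, transl, T.lepImg_of_isSymm hsymm, ha0, hb1]
    ring
  have hP : ∀ α, T.lep α ∈ Finset.univ.image T.lep := fun α =>
    Finset.mem_image_of_mem _ (Finset.mem_univ _)
  have tri : ∀ α β, α = β ∨ T.lep α + T.len α ≤ T.lep β ∨ T.lep β + T.len β ≤ T.lep α := by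
    intro α β
    rcases lt_trichotomy (T.perm0 α) (T.perm0 β) with h | h | h
    · exact Or.inr (Or.inl (T.lep_add_len_le_lep h))
    · exact Or.inl (T.perm0.injective h)
    · exact Or.inr (Or.inr (T.lep_add_len_le_lep h))
  have lo : ∀ α, 0 ≤ T.lep α := fun α => ha0 ▸ T.a_le_lep α
  have hi : ∀ α, T.lep α + T.len α ≤ 1 := fun α => hb1 ▸ T.lep_add_len_le α
  refine ⟨hErg, ?_, ?_, ?_, ?_, ?_, ?_⟩
  · intro x hx
    obtain ⟨α, h1, h2⟩ := key x hx
    rw [val x α h1 h2]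
    have := lo α
    have := hi α
    constructor <;> linarith
  · intro x hx y hy hxy
    obtain ⟨α, h1, h2⟩ := key x hx
    obtain ⟨β, h3, h4⟩ := key y hy
    rw [val x α h1 h2, val y β h3 h4] at hxy
    rcases tri α β with h | h | h
    · subst h
      linarith
    · linarith
    · linarith
  · obtain ⟨α, h1, h2⟩ := key 0 (by simp)
    rw [← le_antisymm h1 (lo α)]
    exact hP α
  · intro a b hab hsub hdisj
    obtain ⟨α, h1, h2⟩ := key ((a + b) / 2) (hsub ⟨by linarith, by linarith⟩)
    refine ⟨1 - 2 * T.lep α - T.len α, fun x hx => ?_⟩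
    obtain ⟨β, h3, h4⟩ := key x (hsub hx)
    rcases tri α β with h | h | h
    · subst h
      rw [val x α h3 h4]
      ring
    · exact absurd ⟨by linarith, by linarith [hx.2]⟩ (hdisj _ (hP β))
    · exact absurd ⟨by linarith [hx.1], by linarith⟩ (hdisj _ (hP α))
  · intro z hz hzP
    obtain ⟨α, h1, h2⟩ := key z hz
    have h1' : T.lep α < z := lt_of_le_of_ne h1 fun h => hzP (h ▸ hP α)
    rw [val z α h1 h2, val _ α (by linarith) (by linarith)]
    ring
  · intro y hy z hz hzP
    obtain ⟨α, h1, h2⟩ := key z hz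
    have h1' : T.lep α < z := lt_of_le_of_ne h1 fun h => hzP (h ▸ hP α)
    obtain ⟨β, h3, h4⟩ := key y hy
    rw [val z α h1 h2, val y β h3 h4]
    rcases tri α β with h | h | h
    · subst h
      congr 1
      · exact if_congr ⟨fun h => by linarith, fun h => by linarith⟩ rfl rfl
      · exact if_congr ⟨fun h => by linarith, fun h => by linarith⟩ rfl rfl
    · rw [if_pos (by linarith), if_pos (by linarith), if_neg (by linarith), if_neg (by linarith)]
      rfl
    · rw [if_neg (by linarith), if_neg (by linarith), if_pos (by linarith), if_pos (by linarith)]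
      rfl

end IET

lemma exists_gaps (F : Finset ℝ) : ∀ p r : ℝ, p < r → ∃ G : Finset (ℝ × ℝ),
    G.card ≤ F.card + 1 ∧
    (∀ g ∈ G, p ≤ g.1 ∧ g.1 < g.2 ∧ g.2 ≤ r ∧ ∀ x ∈ F, x ∉ Ioo g.1 g.2) ∧
    ∀ x ∈ Ioo p r, x ∈ F ∨ ∃ g ∈ G, x ∈ Ioo g.1 g.2 := by
  induction F using Finset.induction_on_max with
  | empty =>
    intro p r hpr
    refine ⟨{(p, r)}, by simp, ?_, ?_⟩
    · simp [hpr]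
    · intro x hx
      exact Or.inr ⟨(p, r), by simp, hx⟩
  | insert m F hm ih =>
    intro p r hpr
    have hmF : m ∉ F := fun h => lt_irrefl _ (hm m h)
    rw [Finset.card_insert_of_notMem hmF]
    rcases le_or_gt m p with hmp | hpm
    · refine ⟨{(p, r)}, by simp, ?_, ?_⟩
      · simp only [Finset.mem_singleton, forall_eq, le_refl, hpr, true_and]
        intro x hx hx'
        rcases Finset.mem_insert.1 hx with rfl | hx
        · linarith [hx'.1]
        · linarith [hx'.1, hm x hx]
      · intro x hx
        exact Or.inr ⟨(p, r), by simp, hx⟩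
    rcases le_or_gt r m with hrm | hmr
    · obtain ⟨G, h1, h2, h3⟩ := ih p r hpr
      refine ⟨G, by omega, fun g hg => ?_, fun x hx => ?_⟩
      · obtain ⟨a1, a2, a3, a4⟩ := h2 g hg
        refine ⟨a1, a2, a3, fun x hx hx' => ?_⟩
        rcases Finset.mem_insert.1 hx with rfl | hx
        · linarith [hx'.2]
        · exact a4 x hx hx'
      · rcases h3 x hx with h | h
        · exact Or.inl (Finset.mem_insert_of_mem h)
        · exact Or.inr h
    · obtain ⟨G, h1, h2, h3⟩ := ih p m hpm
      refine ⟨insert (m, r) G, (Finset.card_insert_le _ _).trans (by omega),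
        fun g hg => ?_, fun x hx => ?_⟩
      · rcases Finset.mem_insert.1 hg with rfl | hg
        · refine ⟨hpm.le, hmr, le_rfl, fun x hx hx' => ?_⟩
          rcases Finset.mem_insert.1 hx with rfl | hx
          · exact lt_irrefl _ hx'.1
          · linarith [hx'.1, hm x hx]
        · obtain ⟨a1, a2, a3, a4⟩ := h2 g hg
          refine ⟨a1, a2, a3.trans hmr.le, fun x hx hx' => ?_⟩
          rcases Finset.mem_insert.1 hx with rfl | hx
          · linarith [hx'.2]
          · exact a4 x hx hx'
      · rcases lt_trichotomy x m with h | rfl | h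
        · rcases h3 x ⟨hx.1, h⟩ with h | ⟨g, hg, hxg⟩
          · exact Or.inl (Finset.mem_insert_of_mem h)
          · exact Or.inr ⟨g, Finset.mem_insert_of_mem hg, hxg⟩
        · exact Or.inl (Finset.mem_insert_self _ _)
        · exact Or.inr ⟨(m, r), Finset.mem_insert_self _ _, h, hx.2⟩

/-- Lebesgue measure on `[0, 1)`. -/
noncomputable abbrev leb01 : Measure ℝ := volume.restrict (Ico (0 : ℝ) 1)

instance : IsProbabilityMeasure leb01 := ⟨by simp [leb01]⟩

lemma leb01_Ioo {a b : ℝ} (h : Ioo a b ⊆ Ico 0 1) : leb01 (Ioo a b) = ENNReal.ofReal (b - a) := by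
  rw [leb01, Measure.restrict_apply measurableSet_Ioo, inter_eq_self_of_subset_left h,
    Real.volume_Ioo]

namespace SymmIET

variable {T : ℝ → ℝ} {P : Finset ℝ}

lemma iterate_mem (hT : SymmIET T P) {x : ℝ} (hx : x ∈ Ico (0 : ℝ) 1) (n : ℕ) :
    T^[n] x ∈ Ico (0 : ℝ) 1 := hT.mapsTo.iterate n hx

lemma iterate_injOn (hT : SymmIET T P) (n : ℕ) : InjOn T^[n] (Ico 0 1) :=
  hT.injOn.iterate hT.mapsTo n

lemma measurePreserving (hT : SymmIET T P) : MeasurePreserving T leb01 leb01 :=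
  hT.erg.toMeasurePreserving

lemma measurable (hT : SymmIET T P) : Measurable T := hT.measurePreserving.measurable

/-- If an open interval inside `(0, ℓ)` contains no point whose orbit hits `ℓ` or a discontinuity
before returning to `(0, ℓ)`, then its points return to `(0, ℓ)` simultaneously, and all iterates
up to that time are translations on it. -/
lemma translates_until_return (hT : SymmIET T P) {ℓ u v x₀ : ℝ} {h : ℕ} (hu : 0 ≤ u)
    (hvℓ : v ≤ ℓ) (hℓ : ℓ < 1) (hx₀ : x₀ ∈ Ioo u v)
    (hret : T^[h] x₀ ∈ Ioo 0 ℓ) (hmin : ∀ i, 0 < i → i < h → T^[i] x₀ ∉ Ioo 0 ℓ)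
    (hP : ∀ x ∈ Ioo u v, x ∉ P)
    (hS : ∀ x ∈ Ioo u v, ∀ j, 0 < j → (∀ i, 0 < i → i < j → T^[i] x ∉ Ioo 0 ℓ) →
      T^[j] x ∉ insert ℓ P) :
    (∀ i ≤ h, ∃ t, ∀ x ∈ Ioo u v, T^[i] x = x + t) ∧
      (∀ n, 0 < n → n < h → ∀ x ∈ Ioo u v, T^[n] x ∉ Ioo 0 ℓ) ∧
      (0 < h → ∀ x ∈ Ioo u v, T^[h] x ∈ Ioo 0 ℓ) := by
  have huv : u < v := hx₀.1.trans hx₀.2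
  have hsub : ∀ x ∈ Ioo u v, x ∈ Ico (0 : ℝ) 1 := fun x hx =>
    ⟨hu.trans hx.1.le, by linarith [hx.2]⟩
  have image : ∀ (j : ℕ) (t : ℝ), (∀ x ∈ Ioo u v, T^[j] x = x + t) →
      Ioo (u + t) (v + t) ⊆ Ico 0 1 := by
    intro j t ht y hy
    have hy' : y - t ∈ Ioo u v := ⟨by linarith [hy.1], by linarith [hy.2]⟩
    have := hT.iterate_mem (hsub _ hy') j
    rw [ht _ hy'] at this
    simpa using this
  have pos : ∀ (j : ℕ) (t : ℝ), (∀ x ∈ Ioo u v, T^[j] x = x + t) → 0 ≤ u + t := by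
    intro j t ht
    by_contra! hneg
    obtain ⟨y, hy1, hy2⟩ := exists_between (lt_min hneg (by linarith : u + t < v + t))
    exact absurd (image j t ht ⟨hy1, hy2.trans_le (min_le_right _ _)⟩).1
      (not_le.2 (hy2.trans_le (min_le_left _ _)))
  have side : ∀ j, 0 < j → (∀ x ∈ Ioo u v, ∀ i, 0 < i → i < j → T^[i] x ∉ Ioo 0 ℓ) →
      (∃ t, ∀ x ∈ Ioo u v, T^[j] x = x + t) →
      ∀ x ∈ Ioo u v, ∀ y ∈ Ioo u v, T^[j] x ∈ Ioo 0 ℓ → T^[j] y ∈ Ioo 0 ℓ := by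
    rintro j hj hno ⟨t, ht⟩ x hx y hy hxL
    have h0 := pos j t ht
    rw [ht x hx] at hxL
    rw [ht y hy]
    refine ⟨by linarith [hy.1], ?_⟩
    by_contra! hcon
    have hz : ℓ - t ∈ Ioo u v := ⟨by linarith [hxL.2, hx.1], by linarith [hy.2]⟩
    refine hS _ hz j hj (hno _ hz) ?_
    rw [ht _ hz]
    simp
  have main : ∀ j, j ≤ h → (∃ t, ∀ x ∈ Ioo u v, T^[j] x = x + t) ∧
      ∀ n, 0 < n → n ≤ j → n < h → ∀ x ∈ Ioo u v, T^[n] x ∉ Ioo 0 ℓ := by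
    intro j
    induction j with
    | zero => exact fun _ => ⟨⟨0, by simp⟩, fun n h1 h2 => by omega⟩
    | succ j ih =>
      intro hj
      obtain ⟨⟨t, ht⟩, hno⟩ := ih (by omega)
      have htr : ∃ t, ∀ x ∈ Ioo u v, T^[j + 1] x = x + t := by
        obtain ⟨t', ht'⟩ := hT.translates (u + t) (v + t) (by linarith) (image j t ht) (by
          intro p hp hpI
          have hx : p - t ∈ Ioo u v := ⟨by linarith [hpI.1], by linarith [hpI.2]⟩
          rcases Nat.eq_zero_or_pos j with rfl | hj0
          · have := ht _ hx
            rw [sub_add_cancel] at this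
            exact hP _ hx (show T^[0] (p - t) ∈ P by rwa [this])
          · refine hS _ hx j hj0 (fun i h1 h2 => hno i h1 h2.le (by omega) _ hx) ?_
            rw [ht _ hx, sub_add_cancel]
            exact Finset.mem_insert_of_mem hp)
        refine ⟨t + t', fun x hx => ?_⟩
        rw [Function.iterate_succ_apply', ht x hx,
          ht' _ ⟨by linarith [hx.1], by linarith [hx.2]⟩, add_assoc]
      refine ⟨htr, fun n h1 h2 h3 x hx hxL => ?_⟩
      rcases Nat.lt_or_ge n (j + 1) with h4 | h4
      · exact hno n h1 (by omega) h3 x hx hxL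
      · obtain rfl : n = j + 1 := by omega
        exact hmin _ h1 h3 (side _ h1 (fun y hy i h5 h6 =>
          hno i h5 (by omega) (by omega) y hy) htr x hx x₀ hx₀ hxL)
  refine ⟨fun i hi => (main i hi).1, fun n h1 h2 => (main h le_rfl).2 n h1 h2.le h2,
    fun hpos x hx => ?_⟩
  exact side h hpos (fun y hy i h1 h2 => (main h le_rfl).2 i h1 h2.le h2 y hy)
    (main h le_rfl).1 x₀ hx₀ x hx hret

/-- The finitely many points of `(0, ℓ)` whose orbit hits `ℓ` or a discontinuity before returning
to `(0, ℓ)`. -/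
lemma exists_singular (hT : SymmIET T P) {ℓ : ℝ} (hℓ : ℓ < 1) :
    ∃ S : Finset ℝ, S.card ≤ P.card + 1 ∧ ∀ x ∈ Ioo 0 ℓ, x ∉ S → ∀ j, 0 < j →
      (∀ i, 0 < i → i < j → T^[i] x ∉ Ioo 0 ℓ) → T^[j] x ∉ insert ℓ P := by
  set H : ℝ → ℝ → Prop := fun τ x => x ∈ Ioo 0 ℓ ∧ ∃ j, 0 < j ∧
    (∀ i, 0 < i → i < j → T^[i] x ∉ Ioo 0 ℓ) ∧ T^[j] x = τ with hH
  have hsub : ∀ x ∈ Ioo 0 ℓ, x ∈ Ico (0 : ℝ) 1 := fun x hx => ⟨hx.1.le, hx.2.trans hℓ⟩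
  have uniq' : ∀ x ∈ Ioo 0 ℓ, ∀ y ∈ Ioo 0 ℓ, ∀ j k, 0 < j → j ≤ k → T^[j] x = T^[k] y →
      (∀ i, 0 < i → i < k → T^[i] y ∉ Ioo 0 ℓ) → x = y := by
    intro x hx y hy j k hj hjk hxy hno
    obtain ⟨d, rfl⟩ := Nat.exists_eq_add_of_le hjk
    rw [Function.iterate_add_apply] at hxy
    have hxd := hT.iterate_injOn j (hsub x hx) (hT.iterate_mem (hsub y hy) d) hxy
    rcases Nat.eq_zero_or_pos d with rfl | hd
    · simpa using hxd
    · exact absurd (hxd ▸ hx) (hno d hd (by omega))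
  have uniq : ∀ τ x y, H τ x → H τ y → x = y := by
    rintro τ x y ⟨hx, j, hj, hj1, hj2⟩ ⟨hy, k, hk, hk1, hk2⟩
    rcases le_total j k with h | h
    · exact uniq' x hx y hy j k hj h (hj2.trans hk2.symm) hk1
    · exact (uniq' y hy x hx k j hk h (hk2.trans hj2.symm) hj1).symm
  refine ⟨(insert ℓ P).image fun τ => if h : ∃ x, H τ x then h.choose else 0,
    Finset.card_image_le.trans (Finset.card_insert_le _ _), ?_⟩
  intro x hx hxS j hj hno hmem
  refine hxS (Finset.mem_image.2 ⟨_, hmem, ?_⟩)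
  have hex : ∃ y, H (T^[j] x) y := ⟨x, hx, j, hj, hno, rfl⟩
  rw [dif_pos hex]
  exact uniq _ _ _ hex.choose_spec ⟨hx, j, hj, hno, rfl⟩

lemma exists_return (hT : SymmIET T P) {u v : ℝ} (hu : 0 ≤ u) (huv : u < v) (hv : v ≤ 1) {s : Set ℝ}
    (hs : Ioo u v ⊆ s) (hs' : MeasurableSet s) : ∃ x ∈ Ioo u v, ∃ n, 0 < n ∧ T^[n] x ∈ s := by
  have hsub : Ioo u v ⊆ Ico 0 1 := fun x hx => ⟨hu.trans hx.1.le, hx.2.trans_le hv⟩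
  have h := hT.measurePreserving.conservative.ae_mem_imp_frequently_image_mem
    hs'.nullMeasurableSet
  by_contra! hcon
  have h0 : leb01 (Ioo u v) = 0 := by
    refine measure_mono_null ?_ h
    intro x hx hcon2
    obtain ⟨n, hn, hn'⟩ := (hcon2 (hs hx)).forall_exists_of_atTop 1
    exact hcon x hx n hn hn'
  rw [leb01_Ioo hsub] at h0
  simp only [ENNReal.ofReal_eq_zero] at h0
  linarith

/-- Rokhlin towers of intervals with measure bounded from below over arbitrarily short bases. -/
theorem exists_tower (hT : SymmIET T P) {ℓ : ℝ} (hℓ0 : 0 < ℓ) (hℓ : ℓ < 1) :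
    ∃ (a b : ℝ) (h : ℕ) (t : ℕ → ℝ), 0 ≤ a ∧ a < b ∧ b ≤ ℓ ∧ 0 < h ∧
      (∀ i < h, ∀ x ∈ Ioo a b, T^[i] x = x + t i) ∧
      (∀ n, 0 < n → n < h → ∀ x ∈ Ioo a b, T^[n] x ∉ Ioo a b) ∧
      1 ≤ (2 * P.card + 2 : ℕ) * (h * (b - a)) := by
  obtain ⟨S, hScard, hS⟩ := hT.exists_singular hℓ
  obtain ⟨G, hGcard, hG, hGcov⟩ := exists_gaps (P ∪ S) 0 ℓ hℓ0
  have hcard : G.card ≤ 2 * P.card + 2 := by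
    have := Finset.card_union_le P S
    omega
  have tower : ∀ g : ℝ × ℝ, ∃ (h : ℕ) (t : ℕ → ℝ), g ∈ G → 0 < h ∧
      (∀ i ≤ h, ∀ x ∈ Ioo g.1 g.2, T^[i] x = x + t i) ∧
      (∀ n, 0 < n → n < h → ∀ x ∈ Ioo g.1 g.2, T^[n] x ∉ Ioo 0 ℓ) ∧
      (∀ x ∈ Ioo g.1 g.2, T^[h] x ∈ Ioo 0 ℓ) := by
    intro g
    by_cases hg : g ∈ G
    swap
    · exact ⟨0, 0, fun h => absurd h hg⟩
    obtain ⟨h1, h2, h3, h4⟩ := hG g hg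
    have hsub : Ioo g.1 g.2 ⊆ Ioo 0 ℓ := Ioo_subset_Ioo h1 h3
    obtain ⟨x₀, hx₀, hex⟩ := hT.exists_return h1 h2 (h3.trans hℓ.le) hsub measurableSet_Ioo
    obtain ⟨hn0, hret⟩ := Nat.find_spec hex
    have hmin : ∀ i, 0 < i → i < Nat.find hex → T^[i] x₀ ∉ Ioo 0 ℓ := fun i hi hlt hmem =>
      Nat.find_min hex hlt ⟨hi, hmem⟩
    obtain ⟨c1, c2, c3⟩ := hT.translates_until_return h1 h3 hℓ hx₀ hret hmin
      (fun x hx hxP => h4 x (Finset.mem_union_left _ hxP) hx)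
      (fun x hx => hS x (hsub hx) fun hxS => h4 x (Finset.mem_union_right _ hxS) hx)
    have : ∀ i, ∃ t, i ≤ Nat.find hex → ∀ x ∈ Ioo g.1 g.2, T^[i] x = x + t := by
      intro i
      by_cases hi : i ≤ Nat.find hex
      · obtain ⟨t, ht⟩ := c1 i hi
        exact ⟨t, fun _ => ht⟩
      · exact ⟨0, fun h => absurd h hi⟩
    choose t ht using this
    exact ⟨Nat.find hex, t, fun _ => ⟨hn0, ht, c2, c3 hn0⟩⟩
  choose h t ht using tower
  set Ω : Set ℝ := ⋃ g ∈ G, ⋃ j ∈ Finset.range (h g), Ioo (g.1 + t g j) (g.2 + t g j) with hΩ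
  have memΩ : ∀ {g}, g ∈ G → ∀ {x}, x ∈ Ioo g.1 g.2 → ∀ {j}, j < h g → T^[j] x ∈ Ω := by
    intro g hg x hx j hj
    rw [(ht g hg).2.1 j hj.le x hx]
    simp only [hΩ, mem_iUnion]
    exact ⟨g, hg, j, Finset.mem_range.2 hj, by linarith [hx.1], by linarith [hx.2]⟩
  have baseΩ : ∀ x ∈ Ioo 0 ℓ, x ∉ P ∪ S → x ∈ Ω := by
    intro x hx hxS
    rcases hGcov x hx with h' | ⟨g, hg, hxg⟩
    · exact absurd h' hxS
    · exact memΩ hg hxg (ht g hg).1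
  have hΩmeas : MeasurableSet Ω := by
    refine Finset.measurableSet_biUnion _ fun g _ => Finset.measurableSet_biUnion _ fun j _ => ?_
    exact measurableSet_Ioo
  have hnull : leb01 (P ∪ S : Finset ℝ) = 0 := Finset.measure_zero _ _
  have hinv : Ω ≤ᵐ[leb01] T ⁻¹' Ω := by
    have h0 : leb01 (T ⁻¹' (P ∪ S : Finset ℝ)) = 0 := by
      rw [hT.measurePreserving.measure_preimage (Finset.measurableSet _).nullMeasurableSet, hnull]
    filter_upwards [measure_eq_zero_iff_ae_notMem.1 h0] with x hx hxΩ
    obtain ⟨g, hg, hxg⟩ := mem_iUnion₂.1 (show x ∈ Ω from hxΩ)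
    obtain ⟨j, hj, hxj⟩ := mem_iUnion₂.1 hxg
    replace hj := Finset.mem_range.1 hj
    have hz : x - t g j ∈ Ioo g.1 g.2 := ⟨by linarith [hxj.1], by linarith [hxj.2]⟩
    have hxz : x = T^[j] (x - t g j) := by rw [(ht g hg).2.1 j hj.le _ hz, sub_add_cancel]
    change T x ∈ Ω
    by_cases hj' : j + 1 < h g
    · rw [hxz, ← Function.iterate_succ_apply' T]
      exact memΩ hg hz hj'
    · have hjh : j + 1 = h g := by omega
      refine baseΩ _ ?_ hx
      rw [hxz, ← Function.iterate_succ_apply' T, show j.succ = h g from hjh]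
      exact (ht g hg).2.2.2 _ hz
  have hpos : leb01 Ω ≠ 0 := by
    intro h0
    have : leb01 (Ioo 0 ℓ) = 0 := by
      refine measure_mono_null (t := Ω ∪ (P ∪ S : Finset ℝ)) ?_ (measure_union_null h0 hnull)
      intro x hx
      by_cases hxS : x ∈ P ∪ S
      · exact Or.inr hxS
      · exact Or.inl (baseΩ x hx hxS)
    rw [leb01_Ioo fun x hx => ⟨hx.1.le, hx.2.trans hℓ⟩] at this
    simp only [ENNReal.ofReal_eq_zero] at this
    linarith
  have hfull : leb01 Ω = 1 := by
    rcases hT.erg.ae_empty_or_univ_of_ae_le_preimage hΩmeas.nullMeasurableSet hinv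
      with h' | h'
    · exact absurd (ae_eq_empty.1 h') hpos
    · rw [measure_congr h', measure_univ]
  have hsum : (1 : ℝ) ≤ ∑ g ∈ G, h g * (g.2 - g.1) := by
    have h1 : leb01 Ω ≤ ∑ g ∈ G, ∑ _j ∈ Finset.range (h g), ENNReal.ofReal (g.2 - g.1) := by
      refine (measure_biUnion_finset_le _ _).trans (Finset.sum_le_sum fun g hg => ?_)
      refine (measure_biUnion_finset_le _ _).trans (Finset.sum_le_sum fun j hj => ?_)
      refine (Measure.restrict_apply_le _ _).trans ?_
      rw [Real.volume_Ioo]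
      exact ENNReal.ofReal_le_ofReal (by linarith)
    rw [hfull] at h1
    have h2 : ∑ g ∈ G, ∑ _j ∈ Finset.range (h g), ENNReal.ofReal (g.2 - g.1) =
        ENNReal.ofReal (∑ g ∈ G, h g * (g.2 - g.1)) := by
      rw [ENNReal.ofReal_sum_of_nonneg]
      · refine Finset.sum_congr rfl fun g hg => ?_
        rw [Finset.sum_const, Finset.card_range, nsmul_eq_mul,
          ENNReal.ofReal_mul (Nat.cast_nonneg _), ENNReal.ofReal_natCast]
      · intro g hg
        have := (hG g hg).2.1
        exact mul_nonneg (Nat.cast_nonneg _) (by linarith)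
    rw [h2] at h1
    exact ENNReal.one_le_ofReal.1 h1
  obtain ⟨g, hg, hgle⟩ : ∃ g ∈ G, 1 ≤ (2 * P.card + 2 : ℕ) * (h g * (g.2 - g.1)) := by
    by_contra! hcon
    have hG0 : G.Nonempty := by
      by_contra! h0
      rw [h0] at hsum
      norm_num at hsum
    have h1 : ∑ g ∈ G, ((2 * P.card + 2 : ℕ) : ℝ) * (h g * (g.2 - g.1)) < ∑ g ∈ G, 1 :=
      Finset.sum_lt_sum_of_nonempty hG0 hcon
    rw [← Finset.mul_sum, Finset.sum_const, nsmul_eq_mul, mul_one] at h1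
    have h2 : ((G.card : ℕ) : ℝ) ≤ (2 * P.card + 2 : ℕ) := by exact_mod_cast hcard
    have h3 : ((2 * P.card + 2 : ℕ) : ℝ) * 1 ≤
        (2 * P.card + 2 : ℕ) * ∑ g ∈ G, (h g * (g.2 - g.1)) :=
      mul_le_mul_of_nonneg_left hsum (Nat.cast_nonneg _)
    linarith
  obtain ⟨c1, c2, c3, -⟩ := hG g hg
  obtain ⟨d1, d2, d3, -⟩ := ht g hg
  exact ⟨g.1, g.2, h g, t g, c1, c2, c3, d1, fun i hi => d2 i hi.le,
    fun n h1 h2 x hx hx' => d3 n h1 h2 x hx (Ioo_subset_Ioo c1 c3 hx'), hgle⟩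

end SymmIET

namespace SymmIET

variable {T : ℝ → ℝ} {P : Finset ℝ}

lemma iterate_reflect (hT : SymmIET T P) {z : ℝ} (hz : z ∈ Ico (0 : ℝ) 1)
    (hzP : ∀ n, T^[n] z ∉ P) (n : ℕ) : T^[n] (1 - T^[n] z) = 1 - z := by
  induction n with
  | zero => rfl
  | succ n ih =>
    rw [Function.iterate_succ_apply T, Function.iterate_succ_apply',
      hT.reflect _ (hT.iterate_mem hz n) (hzP n), ih]

lemma ae_iterate_notMem (hT : SymmIET T P) (F : Finset ℝ) :
    ∀ᵐ z ∂leb01, ∀ n, T^[n] z ∉ F := by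
  rw [ae_all_iff]
  intro n
  have h0 : leb01 (T^[n] ⁻¹' F) = 0 := by
    rw [(hT.measurePreserving.iterate n).measure_preimage (Finset.measurableSet _).nullMeasurableSet]
    exact Finset.measure_zero _ _
  exact measure_eq_zero_iff_ae_notMem.1 h0

lemma ae_exists_iterate_mem (hT : SymmIET T P) {s : Set ℝ} (hs : MeasurableSet s)
    (hs0 : leb01 s ≠ 0) : ∀ᵐ z ∂leb01, ∃ n, T^[n] z ∈ s := by
  have hW : MeasurableSet (⋃ n, T^[n] ⁻¹' s) :=
    MeasurableSet.iUnion fun n => (hT.measurable.iterate n) hs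
  have hsub : T ⁻¹' (⋃ n, T^[n] ⁻¹' s) ⊆ ⋃ n, T^[n] ⁻¹' s := by
    intro z hz
    obtain ⟨n, hn⟩ := mem_iUnion.1 (mem_preimage.1 hz)
    exact mem_iUnion.2 ⟨n + 1, hn⟩
  rcases hT.erg.ae_empty_or_univ_of_preimage_ae_le hW.nullMeasurableSet
    (Filter.Eventually.of_forall hsub) with h | h
  · refine absurd (measure_mono_null ?_ (ae_eq_empty.1 h)) hs0
    exact fun z hz => mem_iUnion.2 ⟨0, hz⟩
  · filter_upwards [Filter.eventuallyEq_univ.1 h] with z hz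
    exact mem_iUnion.1 hz

end SymmIET

/-- `1` if the proposition holds and `0` otherwise. -/
noncomputable def ind (p : Prop) : ℤ := if p then 1 else 0

lemma ind_of {p : Prop} (h : p) : ind p = 1 := if_pos h

lemma ind_of_not {p : Prop} (h : ¬p) : ind p = 0 := if_neg h

lemma abs_ind_sub_ind_le_one (p q : Prop) : |ind p - ind q| ≤ 1 := by
  unfold ind
  split_ifs <;> simp

lemma abs_ind_lt_sub_le {c e w w' y : ℝ} (hw : w ∈ Ioo c e) (hw' : w' ∈ Ioo c e) :
    |ind (y < w) - ind (y < w')| ≤ ind (y ∈ Ioo c e) := by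
  by_cases hy : y ∈ Ioo c e
  · rw [ind_of hy]
    exact abs_ind_sub_ind_le_one _ _
  · have : (y < w) ↔ (y < w') := by
      constructor
      · intro h
        by_contra! h'
        exact hy ⟨by linarith [hw'.1], by linarith [hw.2]⟩
      · intro h
        by_contra! h'
        exact hy ⟨by linarith [hw.1], by linarith [hw'.2]⟩
    rw [ind_of_not hy, this]
    simp

lemma abs_ind_ne_sub_le {c e w y : ℝ} (hw : w ∈ Ioo c e) :
    |ind (w < y) + ind (y < w) - 1| ≤ ind (y ∈ Ioo c e) := by
  rcases lt_trichotomy w y with h | rfl | h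
  · rw [ind_of h, ind_of_not h.le.not_gt]
    unfold ind
    split_ifs <;> simp
  · rw [ind_of hw, ind_of_not (lt_irrefl _)]
    simp
  · rw [ind_of h, ind_of_not h.le.not_gt]
    unfold ind
    split_ifs <;> simp

/-- The discrepancy at `z` between the first `q` points of the orbit of `x` and their
reflections. -/
noncomputable def discr (T : ℝ → ℝ) (x : ℝ) (q : ℕ) (z : ℝ) : ℤ :=
  ∑ j ∈ Finset.range q, (ind (T^[j] x < z) - ind (1 - T^[j] x < z))

lemma integral_ind_lt {y : ℝ} (hy0 : 0 ≤ y) (hy1 : y ≤ 1) :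
    Integrable (fun z => (ind (y < z) : ℝ)) leb01 ∧
      ∫ z, (ind (y < z) : ℝ) ∂leb01 = 1 - y := by
  have h1 : (fun z => (ind (y < z) : ℝ)) = (Ioi y).indicator 1 := by
    ext z
    unfold ind indicator
    by_cases h : y < z <;> simp [h]
  have hI : Ioi y ∩ Ico 0 1 = if y = 0 then Ioo 0 1 else Ioo y 1 := by
    ext z
    split_ifs with h
    · subst h
      simp only [mem_inter_iff, mem_Ioi, mem_Ico, mem_Ioo]
      exact ⟨fun h => ⟨h.1, h.2.2⟩, fun h => ⟨h.1, h.1.le, h.2⟩⟩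
    · simp only [mem_inter_iff, mem_Ioi, mem_Ico, mem_Ioo]
      exact ⟨fun h => ⟨h.1, h.2.2⟩, fun h => ⟨h.1, hy0.trans h.1.le, h.2⟩⟩
  rw [h1]
  refine ⟨(integrable_const (1 : ℝ)).indicator measurableSet_Ioi, ?_⟩
  rw [integral_indicator_one measurableSet_Ioi, Measure.real, leb01,
    Measure.restrict_apply measurableSet_Ioi, hI]
  split_ifs with h
  · subst h
    simp
  · rw [Real.volume_Ioo, ENNReal.toReal_ofReal (by linarith)]

namespace SymmIET

variable {T : ℝ → ℝ} {P : Finset ℝ}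

lemma discr_apply_sub (hT : SymmIET T P) {x z : ℝ} (hx : x ∈ Ico (0 : ℝ) 1)
    (hz : z ∈ Ico (0 : ℝ) 1) (hzP : z ∉ P) (q : ℕ) :
    discr T x q (T z) - discr T x q z =
      (ind (x < T z) - ind (T^[q] x < T z)) +
        (ind (1 - x < z) - ind (1 - T^[q] x < z)) := by
  unfold discr
  induction q with
  | zero => simp
  | succ q ih =>
    have h := hT.exch _ (hT.iterate_mem hx q) z hz hzP
    rw [← Function.iterate_succ_apply' T] at h
    have h' : ind (1 - T z < T^[q] x) = ind (1 - T^[q] x < T z) := by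
      congr 1
      exact propext ⟨fun h => by linarith, fun h => by linarith⟩
    change ind (T^[q + 1] x < T z) - ind (1 - T z < T^[q] x) =
      ind (T^[q] x < z) - ind (1 - T^[q + 1] x < z) at h
    rw [Finset.sum_range_succ, Finset.sum_range_succ]
    linarith

/-- The Birkhoff sums of `x - 1/2` are bounded along orbit segments between two visits to an
interval whose number of visits to the interval and to its reflection is bounded. -/
theorem abs_sum_le (hT : SymmIET T P) {x c e : ℝ} {q : ℕ} {C : ℤ} (hx : x ∈ Ico (0 : ℝ) 1)
    (hx0 : ∀ j < q, T^[j] x ≠ 0) (hU : leb01 (Ioo c e) ≠ 0) (hxU : x ∈ Ioo c e)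
    (hqU : T^[q] x ∈ Ioo c e)
    (hC : ∑ j ∈ Finset.range q, (ind (T^[j] x ∈ Ioo c e) + ind (1 - T^[j] x ∈ Ioo c e)) ≤ C) :
    |∑ j ∈ Finset.range q, (T^[j] x - 1 / 2)| ≤ 2 * C + 1 := by
  set m := discr T x q with hm
  have hC0 : 0 ≤ C := le_trans (Finset.sum_nonneg fun j _ => by
    unfold ind; split_ifs <;> norm_num) hC
  have hUU : ∀ w ∈ Ioo c e, ∀ w' ∈ Ioo c e, |m w - m w'| ≤ C := by
    intro w hw w' hw'
    rw [hm, discr, discr, ← Finset.sum_sub_distrib]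
    refine (Finset.abs_sum_le_sum_abs _ _).trans (le_trans (Finset.sum_le_sum fun j _ => ?_) hC)
    have h1 := abs_ind_lt_sub_le (y := T^[j] x) hw hw'
    have h2 := abs_ind_lt_sub_le (y := 1 - T^[j] x) hw hw'
    rw [abs_le] at h1 h2 ⊢
    constructor <;> linarith [h1.1, h1.2, h2.1, h2.2]
  have hrefl : ∀ w ∈ Ioo c e, |m (1 - w) - m w| ≤ C := by
    intro w hw
    rw [hm, discr, discr, ← Finset.sum_sub_distrib]
    refine (Finset.abs_sum_le_sum_abs _ _).trans (le_trans (Finset.sum_le_sum fun j _ => ?_) hC)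
    have h1 := abs_ind_ne_sub_le (y := T^[j] x) hw
    have h2 := abs_ind_ne_sub_le (y := 1 - T^[j] x) hw
    have h3 : ind (1 - T^[j] x < 1 - w) = ind (w < T^[j] x) := by
      congr 1
      exact propext ⟨fun h => by linarith, fun h => by linarith⟩
    have h4 : ind (T^[j] x < 1 - w) = ind (w < 1 - T^[j] x) := by
      congr 1
      exact propext ⟨fun h => by linarith, fun h => by linarith⟩
    rw [h3, h4]
    rw [abs_le] at h1 h2 ⊢
    constructor <;> linarith [h1.1, h1.2, h2.1, h2.2]
  have hvisit : ∀ w, w ∈ Ioo c e ∨ 1 - w ∈ Ioo c e → |m w - m x| ≤ 2 * C := by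
    rintro w (hw | hw)
    · exact (hUU w hw x hxU).trans (by linarith)
    · have h1 := hrefl _ hw
      have h2 := hUU _ hw x hxU
      rw [sub_sub_cancel] at h1
      rw [abs_le] at h1 h2 ⊢
      constructor <;> linarith [h1.1, h1.2, h2.1, h2.2]
  have side : ∀ w, w ∉ Ioo c e → ind (x < w) - ind (T^[q] x < w) = 0 := by
    intro w hw
    have : (x < w) ↔ (T^[q] x < w) := by
      constructor
      · intro h
        by_contra! h'
        exact hw ⟨by linarith [hxU.1], by linarith [hqU.2]⟩
      · intro h
        by_contra! h'
        exact hw ⟨by linarith [hqU.1], by linarith [hxU.2]⟩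
    rw [this, sub_self]
  have side' : ∀ w, 1 - w ∉ Ioo c e → ind (1 - x < w) - ind (1 - T^[q] x < w) = 0 := by
    intro w hw
    have : (1 - x < w) ↔ (1 - T^[q] x < w) := by
      constructor
      · intro h
        by_contra! h'
        exact hw ⟨by linarith [hqU.1], by linarith [hxU.2]⟩
      · intro h
        by_contra! h'
        exact hw ⟨by linarith [hxU.1], by linarith [hqU.2]⟩
    rw [this, sub_self]
  have hclose : ∀ z ∈ Ico (0 : ℝ) 1, (∀ n, T^[n] z ∉ P) → (∃ n, T^[n] z ∈ Ioo c e) →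
      |m z - m x| ≤ 2 * C + 1 := by
    intro z hz hzP hex
    have hex' : ∃ n, T^[n] z ∈ Ioo c e ∨ 1 - T^[n] z ∈ Ioo c e :=
      hex.imp fun n hn => Or.inl hn
    have hn := Nat.find_spec hex'
    have hmin : ∀ i < Nat.find hex', T^[i] z ∉ Ioo c e ∧ 1 - T^[i] z ∉ Ioo c e :=
      fun i hi => not_or.1 (Nat.find_min hex' hi)
    generalize Nat.find hex' = n at hn hmin
    have hconst : ∀ i, i < n → m (T^[i] z) = m z := by
      intro i
      induction i with
      | zero => exact fun _ => rfl
      | succ i ih =>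
        intro hi
        have h1 := hT.discr_apply_sub hx (hT.iterate_mem hz i) (hzP i) q
        rw [← Function.iterate_succ_apply' T, side _ (hmin _ hi).1,
          side' _ (hmin i (by omega)).2, ← hm] at h1
        have h2 : m (T^[i + 1] z) = m (T^[i] z) := by
          change m (T^[i.succ] z) = _
          linarith
        rw [h2, ih (by omega)]
    have h1 := hvisit _ hn
    suffices |m (T^[n] z) - m z| ≤ 1 by
      rw [abs_le] at h1 this ⊢
      constructor <;> linarith [h1.1, h1.2, this.1, this.2]
    rcases n with _ | n
    · simp
    · have h2 := hT.discr_apply_sub hx (hT.iterate_mem hz n) (hzP n) q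
      rw [← Function.iterate_succ_apply' T, side' _ (hmin n (by omega)).2, ← hm, add_zero,
        hconst n (by omega)] at h2
      change |m (T^[n.succ] z) - m z| ≤ 1
      rw [h2]
      exact abs_ind_sub_ind_le_one _ _
  have hgen : ∀ᵐ z ∂leb01, |m z - m x| ≤ 2 * C + 1 := by
    filter_upwards [hT.ae_iterate_notMem P, hT.ae_exists_iterate_mem measurableSet_Ioo hU,
      ae_restrict_mem measurableSet_Ico] with z h1 h2 h3
    exact hclose z h3 h1 h2
  have hmx : |m x| ≤ 2 * C + 1 := by
    obtain ⟨δ, hδ0, hδ1, hδ⟩ : ∃ δ, 0 < δ ∧ δ ≤ 1 ∧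
        ∀ j < q, δ ≤ T^[j] x ∧ δ ≤ 1 - T^[j] x := by
      have : ∀ k ≤ q, ∃ δ, 0 < δ ∧ δ ≤ 1 ∧ ∀ j < k, δ ≤ T^[j] x ∧ δ ≤ 1 - T^[j] x := by
        intro k
        induction k with
        | zero => exact fun _ => ⟨1, by norm_num, le_rfl, by simp⟩
        | succ k ih =>
          intro hk
          obtain ⟨δ, h0, h1, h2⟩ := ih (by omega)
          have hk1 := hT.iterate_mem hx k
          have hk2 := (hx0 k (by omega)).symm.lt_of_le hk1.1
          refine ⟨min δ (min (T^[k] x) (1 - T^[k] x)), lt_min h0 (lt_min hk2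
            (by linarith [hk1.2])), (min_le_left _ _).trans h1, fun j hj => ?_⟩
          rcases Nat.lt_succ_iff_lt_or_eq.1 hj with hj | rfl
          · exact ⟨(min_le_left _ _).trans (h2 j hj).1, (min_le_left _ _).trans (h2 j hj).2⟩
          · exact ⟨(min_le_right _ _).trans (min_le_left _ _),
              (min_le_right _ _).trans (min_le_right _ _)⟩
      exact this q le_rfl
    obtain ⟨z, hz, hzm⟩ : ∃ z ∈ Ioo 0 δ, |m z - m x| ≤ 2 * C + 1 := by
      by_contra! hcon
      have h0 : leb01 (Ioo 0 δ) = 0 :=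
        measure_mono_null (fun z hz => not_le.2 (hcon z hz)) hgen
      rw [leb01_Ioo fun y hy => ⟨hy.1.le, hy.2.trans_le hδ1⟩] at h0
      simp only [ENNReal.ofReal_eq_zero] at h0
      linarith
    have hz0 : m z = 0 := by
      refine Finset.sum_eq_zero fun j hj => ?_
      have := hδ j (Finset.mem_range.1 hj)
      rw [ind_of_not (by linarith [hz.2]), ind_of_not (by linarith [hz.2]), sub_zero]
    rwa [hz0, zero_sub, abs_neg] at hzm
  have hint : ∫ z, (m z : ℝ) ∂leb01 = -2 * ∑ j ∈ Finset.range q, (T^[j] x - 1 / 2) := by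
    have hj : ∀ j, T^[j] x ∈ Ico (0 : ℝ) 1 := fun j => hT.iterate_mem hx j
    have h1 : ∀ j, _ := fun j => integral_ind_lt (hj j).1 (hj j).2.le
    have h2 : ∀ j, _ := fun j =>
      integral_ind_lt (y := 1 - T^[j] x) (by linarith [(hj j).2]) (by linarith [(hj j).1])
    simp only [hm, discr, Int.cast_sum, Int.cast_sub]
    rw [integral_finsetSum _ fun j _ => by exact (h1 j).1.sub (h2 j).1, Finset.mul_sum]
    refine Finset.sum_congr rfl fun j _ => ?_
    rw [integral_sub (h1 j).1 (h2 j).1, (h1 j).2, (h2 j).2]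
    ring
  have hbound : ‖∫ z, (m z : ℝ) ∂leb01‖ ≤ (4 * C + 2) * leb01.real univ := by
    refine norm_integral_le_of_norm_le_const ?_
    filter_upwards [hgen] with z hz
    rw [Real.norm_eq_abs, ← Int.cast_abs]
    have : |m z| ≤ 4 * C + 2 := by
      rw [abs_le] at hz hmx ⊢
      constructor <;> linarith [hz.1, hz.2, hmx.1, hmx.2]
    exact_mod_cast this
  rw [hint, probReal_univ, norm_mul, Real.norm_eq_abs, Real.norm_eq_abs] at hbound
  have h2 : |(-2 : ℝ)| = 2 := by norm_num
  rw [h2, mul_one] at hbound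
  linarith

end SymmIET

lemma card_le_of_separated {S : Finset ℕ} {h M : ℕ} (hS : ∀ j ∈ S, j < M * h)
    (hsep : ∀ i ∈ S, ∀ j ∈ S, i < j → h ≤ j - i) : S.card ≤ M := by
  rcases Nat.eq_zero_or_pos h with rfl | hh
  · have : S = ∅ := Finset.eq_empty_of_forall_notMem fun j hj => by simpa using hS j hj
    simp [this]
  rw [← Finset.card_range M]
  refine Finset.card_le_card_of_injOn (· / h) (fun j hj => ?_) ?_
  · exact Finset.mem_coe.2 (Finset.mem_range.2 (Nat.div_lt_of_lt_mul (mul_comm M h ▸ hS j hj)))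
  · have aux : ∀ i ∈ S, ∀ j ∈ S, i < j → i / h ≠ j / h := by
      intro i hi j hj hij heq
      have h1 := hsep i hi j hj hij
      have h2 : (i + h) / h ≤ j / h := Nat.div_le_div_right (by omega)
      rw [Nat.add_div_right _ hh] at h2
      omega
    intro i hi j hj hij
    rcases lt_trichotomy i j with h' | h' | h'
    · exact absurd hij (aux i hi j hj h')
    · exact h'
    · exact absurd hij.symm (aux j hj i hi h')

namespace SymmIET

variable {T : ℝ → ℝ} {P : Finset ℝ}

lemma lintegral_comp_iterate_le (hT : SymmIET T P) {E : Set ℝ} (hE : MeasurableSet E)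
    (hsub : E ⊆ Ico 0 1) {k : ℝ → ℕ} (hk : Measurable k)
    (hinj : InjOn (fun x => T^[k x] x) E) {β : ℝ → ENNReal} (hβ : Measurable β) :
    ∫⁻ x in E, β (T^[k x] x) ∂leb01 ≤ ∫⁻ x, β x ∂leb01 := by
  set E' : ℕ → Set ℝ := fun n => E ∩ k ⁻¹' {n} with hE'
  have hE'm : ∀ n, MeasurableSet (E' n) := fun n => hE.inter (hk (measurableSet_singleton n))
  have hE'd : Pairwise (Function.onFun Disjoint E') := by
    intro m n hmn
    exact disjoint_left.2 fun x hx hx' => hmn (hx.2.symm.trans hx'.2)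
  have hEU : E = ⋃ n, E' n := by
    ext x
    simp [hE']
  have hinj' : ∀ n, InjOn T^[n] (E' n) := fun n =>
    (hT.iterate_injOn n).mono (inter_subset_left.trans hsub)
  set G : ℕ → Set ℝ := fun n => T^[n] '' E' n with hG
  have hGm : ∀ n, MeasurableSet (G n) := fun n =>
    (hE'm n).image_of_measurable_injOn (hT.measurable.iterate n) (hinj' n)
  have hGd : Pairwise (Function.onFun Disjoint G) := by
    intro m n hmn
    refine disjoint_left.2 ?_
    rintro _ ⟨x, hx, rfl⟩ ⟨y, hy, hxy⟩
    have hkx : k x = m := hx.2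
    have hky : k y = n := hy.2
    have : y = x := hinj hy.1 hx.1 (by simpa only [hkx, hky] using hxy)
    exact hmn (by rw [← hkx, ← hky, this])
  have hpre : ∀ n, T^[n] ⁻¹' (G n) ∩ Ico 0 1 ⊆ E' n := by
    rintro n x ⟨⟨y, hy, hyx⟩, hx⟩
    rwa [← hT.iterate_injOn n (hsub hy.1) hx hyx]
  have hone : ∀ n, ∫⁻ x in E' n, β (T^[k x] x) ∂leb01 = ∫⁻ x in G n, β x ∂leb01 := by
    intro n
    rw [← (hT.measurePreserving.iterate n).setLIntegral_comp_preimage (hGm n) hβ]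
    have hset : T^[n] ⁻¹' (G n) =ᵐ[leb01] E' n := by
      filter_upwards [ae_restrict_mem measurableSet_Ico] with x hx
      exact propext ⟨fun h => hpre n ⟨h, hx⟩, fun h => ⟨x, h, rfl⟩⟩
    rw [setLIntegral_congr hset]
    refine setLIntegral_congr_fun (hE'm n) fun x hx => ?_
    have hkx : k x = n := hx.2
    simp only [hkx]
  calc ∫⁻ x in E, β (T^[k x] x) ∂leb01
      = ∑' n, ∫⁻ x in E' n, β (T^[k x] x) ∂leb01 := by
        conv_lhs => rw [hEU]
        rw [lintegral_iUnion hE'm hE'd]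
    _ = ∫⁻ x in ⋃ n, G n, β x ∂leb01 := by
        rw [lintegral_iUnion hGm hGd]
        exact tsum_congr hone
    _ ≤ ∫⁻ x, β x ∂leb01 := setLIntegral_le_lintegral _ _

lemma measure_no_return_le (hT : SymmIET T P) {U : Set ℝ} (hU : MeasurableSet U) (n : ℕ) :
    (n + 1 : ℕ) * leb01 {x | x ∈ U ∧ ∀ m, 0 < m → m ≤ n → T^[m] x ∉ U} ≤ 1 := by
  set V := {x | x ∈ U ∧ ∀ m, 0 < m → m ≤ n → T^[m] x ∉ U} with hV
  have hVm : MeasurableSet V := by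
    have hset : V = U ∩ ⋂ m : ℕ, ⋂ _ : 0 < m, ⋂ _ : m ≤ n, (T^[m] ⁻¹' U)ᶜ := by
      ext x
      simp [hV]
    rw [hset]
    exact hU.inter (MeasurableSet.iInter fun m => MeasurableSet.iInter fun _ =>
      MeasurableSet.iInter fun _ => ((hT.measurable.iterate m) hU).compl)
  have hdisj : (Finset.range (n + 1) : Set ℕ).PairwiseDisjoint fun j => T^[j] ⁻¹' V := by
    have aux : ∀ i j, i < j → j < n + 1 → ∀ x, T^[i] x ∈ V → T^[j] x ∉ V := by
      intro i j hij hj x hx hx'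
      obtain ⟨d, rfl⟩ := Nat.exists_eq_add_of_lt hij
      refine hx.2 (d + 1) (by omega) (by omega) ?_
      rw [← Function.iterate_add_apply]
      convert hx'.1 using 2
      omega
    intro i hi j hj hij
    have hi' := Finset.mem_range.1 (Finset.mem_coe.1 hi)
    have hj' := Finset.mem_range.1 (Finset.mem_coe.1 hj)
    refine disjoint_left.2 fun x hx hx' => ?_
    rcases lt_or_gt_of_ne hij with h | h
    · exact aux i j h hj' x hx hx'
    · exact aux j i h hi' x hx' hx
  have h1 : ∀ j, leb01 (T^[j] ⁻¹' V) = leb01 V := fun j =>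
    (hT.measurePreserving.iterate j).measure_preimage hVm.nullMeasurableSet
  have h2 := measure_biUnion_finset (μ := leb01) hdisj
    fun j _ => (hT.measurable.iterate j) hVm
  simp only [h1, Finset.sum_const, Finset.card_range, nsmul_eq_mul] at h2
  rw [← h2]
  exact prob_le_one

lemma measure_near_le (hT : SymmIET T P) (F : Finset ℝ) (n : ℕ) (ρ : ℝ) :
    leb01 {x | ∃ j < n, ∃ p ∈ F, |T^[j] x - p| < ρ} ≤
      n * (F.card * ENNReal.ofReal (2 * ρ)) := by
  have hset : {x | ∃ j < n, ∃ p ∈ F, |T^[j] x - p| < ρ} =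
      ⋃ j ∈ Finset.range n, T^[j] ⁻¹' ⋃ p ∈ F, Metric.ball p ρ := by
    ext x
    simp [Real.dist_eq]
  rw [hset]
  refine (measure_biUnion_finset_le _ _).trans ?_
  refine (Finset.sum_le_card_nsmul _ _ (F.card * ENNReal.ofReal (2 * ρ)) fun j _ => ?_).trans_eq
    (by rw [Finset.card_range, nsmul_eq_mul])
  rw [(hT.measurePreserving.iterate j).measure_preimage
    (Finset.measurableSet_biUnion _ fun _ _ => measurableSet_ball).nullMeasurableSet]
  refine (measure_biUnion_finset_le _ _).trans ?_
  rw [← nsmul_eq_mul]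
  refine Finset.sum_le_card_nsmul _ _ _ fun p _ => ?_
  refine (Measure.restrict_apply_le _ _).trans ?_
  rw [Real.volume_ball]

lemma iterate_add_of_far (hT : SymmIET T P) {x ρ : ℝ} {n : ℕ} (hx : x ∈ Ico (0 : ℝ) 1)
    (hfar : ∀ j < n, ∀ p ∈ insert 1 P, ρ ≤ |T^[j] x - p|) {u : ℝ} (hu : |u| < ρ) :
    ∀ j ≤ n, T^[j] (x + u) = T^[j] x + u := by
  intro j
  induction j with
  | zero => exact fun _ => rfl
  | succ j ih =>
    intro hj
    have hρ : 0 < ρ := (abs_nonneg u).trans_lt hu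
    have hmem := hT.iterate_mem hx j
    have h0 := hfar j hj 0 (Finset.mem_insert_of_mem hT.zero_mem)
    have h1 := hfar j hj 1 (Finset.mem_insert_self _ _)
    rw [sub_zero, abs_of_nonneg hmem.1] at h0
    rw [abs_sub_comm, abs_of_nonneg (by linarith [hmem.2])] at h1
    obtain ⟨t, ht⟩ := hT.translates (T^[j] x - ρ) (T^[j] x + ρ) (by linarith)
      (fun y hy => ⟨by linarith [hy.1], by linarith [hy.2]⟩) (by
        intro p hp hpI
        have h2 := hfar j hj p (Finset.mem_insert_of_mem hp)
        have h3 : |T^[j] x - p| < ρ := abs_lt.2 ⟨by linarith [hpI.2], by linarith [hpI.1]⟩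
        linarith)
    rw [abs_lt] at hu
    rw [Function.iterate_succ_apply', Function.iterate_succ_apply', ih (by omega),
      ht _ ⟨by linarith [hu.1], by linarith [hu.2]⟩, ht _ ⟨by linarith, by linarith⟩]
    ring

end SymmIET

/-- A Rokhlin tower whose levels are the intervals `(a + t i, b + t i)`, `i < h`. -/
structure IntervalTower (T : ℝ → ℝ) (a b : ℝ) (h : ℕ) (t : ℕ → ℝ) : Prop where
  nonneg : 0 ≤ a
  lt : a < b
  le_one : b ≤ 1
  height_pos : 0 < h
  iterate_eq : ∀ i < h, ∀ x ∈ Ioo a b, T^[i] x = x + t i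
  no_return : ∀ n, 0 < n → n < h → ∀ x ∈ Ioo a b, T^[n] x ∉ Ioo a b

namespace IntervalTower

variable {T : ℝ → ℝ} {P : Finset ℝ} {a b : ℝ} {h : ℕ} {t : ℕ → ℝ}

lemma base_subset (hK : IntervalTower T a b h t) : Ioo a b ⊆ Ico 0 1 := fun _ hx =>
  ⟨hK.nonneg.trans hx.1.le, hx.2.trans_le hK.le_one⟩

lemma exists_base (hK : IntervalTower T a b h t) {i : ℕ} (hi : i < h) {y : ℝ}
    (hy : y ∈ Ioo (a + t i) (b + t i)) : ∃ x ∈ Ioo a b, T^[i] x = y := by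
  have hx : y - t i ∈ Ioo a b := ⟨by linarith [hy.1], by linarith [hy.2]⟩
  exact ⟨_, hx, by rw [hK.iterate_eq i hi _ hx, sub_add_cancel]⟩

lemma level_subset (hK : IntervalTower T a b h t) (hT : SymmIET T P) {i : ℕ} (hi : i < h) :
    Ioo (a + t i) (b + t i) ⊆ Ico 0 1 := by
  intro y hy
  obtain ⟨x, hx, rfl⟩ := hK.exists_base hi hy
  exact hT.iterate_mem (hK.base_subset hx) i

lemma leb01_level (hK : IntervalTower T a b h t) (hT : SymmIET T P) {i : ℕ} (hi : i < h) :
    leb01 (Ioo (a + t i) (b + t i)) = ENNReal.ofReal (b - a) := by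
  rw [leb01_Ioo (hK.level_subset hT hi), add_sub_add_right_eq_sub]

lemma level_unique (hK : IntervalTower T a b h t) (hT : SymmIET T P) {i j : ℕ} (hi : i < h)
    (hj : j < h) {y : ℝ} (hyi : y ∈ Ioo (a + t i) (b + t i))
    (hyj : y ∈ Ioo (a + t j) (b + t j)) : i = j := by
  have aux : ∀ i j, i < j → j < h → y ∈ Ioo (a + t i) (b + t i) →
      y ∉ Ioo (a + t j) (b + t j) := by
    intro i j hij hj hyi hyj
    obtain ⟨x, hx, hxy⟩ := hK.exists_base (hij.trans hj) hyi
    obtain ⟨x', hx', hxy'⟩ := hK.exists_base hj hyj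
    obtain ⟨d, rfl⟩ := Nat.exists_eq_add_of_lt hij
    rw [add_assoc, Function.iterate_add_apply, ← hxy] at hxy'
    have := hT.iterate_injOn i (hT.iterate_mem (hK.base_subset hx') (d + 1))
      (hK.base_subset hx) hxy'
    exact hK.no_return (d + 1) (by omega) (by omega) x' hx' (this ▸ hx)
  rcases lt_trichotomy i j with h' | h' | h'
  · exact absurd hyj (aux i j h' hj hyi)
  · exact h'
  · exact absurd hyi (aux j i h' hi hyj)

lemma height_le_of_return (hK : IntervalTower T a b h t) (hT : SymmIET T P) {i n : ℕ}
    (hi : i < h) (hn : 0 < n) {y : ℝ} (hy : y ∈ Ioo (a + t i) (b + t i))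
    (hyn : T^[n] y ∈ Ioo (a + t i) (b + t i)) : h ≤ n := by
  by_contra! hlt
  obtain ⟨x, hx, hxy⟩ := hK.exists_base hi hy
  obtain ⟨x', hx', hxy'⟩ := hK.exists_base hi hyn
  rw [← hxy, ← Function.iterate_add_apply, add_comm, Function.iterate_add_apply] at hxy'
  have := hT.iterate_injOn i (hK.base_subset hx') (hT.iterate_mem (hK.base_subset hx) n) hxy'
  exact hK.no_return n hn hlt x hx (this ▸ hx')

lemma sum_visits_le (hK : IntervalTower T a b h t) (hT : SymmIET T P) {i M q : ℕ} (hi : i < h)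
    (hq : q ≤ M * h) {x : ℝ} (hx : x ∈ Ico (0 : ℝ) 1) (hxP : ∀ n, T^[n] x ∉ P) :
    ∑ j ∈ Finset.range q, (ind (T^[j] x ∈ Ioo (a + t i) (b + t i)) +
      ind (1 - T^[j] x ∈ Ioo (a + t i) (b + t i))) ≤ 2 * M := by
  have hcount : ∀ p : ℕ → Prop, (∀ m n, m < n → p m → p n → h ≤ n - m) →
      ∑ j ∈ Finset.range q, ind (p j) ≤ M := by
    intro p hp
    simp only [ind]
    rw [Finset.sum_boole]
    exact_mod_cast card_le_of_separated
      (fun j hj => (Finset.mem_range.1 (Finset.mem_filter.1 hj).1).trans_le hq)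
      fun m hm n hn hmn => hp m n hmn (Finset.mem_filter.1 hm).2 (Finset.mem_filter.1 hn).2
  rw [Finset.sum_add_distrib, two_mul]
  refine add_le_add (hcount _ fun m n hmn hm hn => ?_) (hcount _ fun m n hmn hm hn => ?_)
  · refine hK.height_le_of_return hT hi (by omega) hm ?_
    rwa [← Function.iterate_add_apply, Nat.sub_add_cancel hmn.le]
  · refine hK.height_le_of_return hT hi (by omega) hn ?_
    have h1 := hT.iterate_reflect (hT.iterate_mem hx m)
      (fun k => by rw [← Function.iterate_add_apply]; exact hxP _) (n - m)
    rw [← Function.iterate_add_apply, Nat.sub_add_cancel hmn.le] at h1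
    rwa [h1]

/-- Returns to the levels of a tower within a bounded multiple of its height, on a set of large
measure. -/
theorem exists_returns (hK : IntervalTower T a b h t) (hT : SymmIET T P) {M : ℕ} (hM : 0 < M)
    {ρ : ℝ} (hρ : 0 ≤ ρ) :
    ∃ (E : Set ℝ) (k : ℝ → ℕ), MeasurableSet E ∧ E ⊆ Ico 0 1 ∧ Measurable k ∧
      h * (b - a) - 1 / M - M * h * ((P.card + 1) * (2 * ρ)) ≤ leb01.real E ∧
      (∀ x ∈ E, h ≤ k x ∧ k x ≤ M * h) ∧
      (∀ x ∈ E, ∀ u, |u| < ρ → ∀ j ≤ k x, T^[j] (x + u) = T^[j] x + u) ∧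
      (∀ x ∈ E, |∑ j ∈ Finset.range (k x), (T^[j] x - 1 / 2)| ≤ 4 * M + 1) ∧
      InjOn (fun x => T^[k x] x) E := by
  set U : ℕ → Set ℝ := fun i => Ioo (a + t i) (b + t i) with hU
  have hUm : ∀ i, MeasurableSet (U i) := fun i => measurableSet_Ioo
  set p : ℝ → ℕ → Prop := fun x n =>
    (0 < n ∧ ∃ i ∈ Finset.range h, x ∈ U i ∧ T^[n] x ∈ U i) ∨ n = M * h + 1 with hp
  have hex : ∀ x, ∃ n, p x n := fun x => ⟨M * h + 1, Or.inr rfl⟩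
  have hpm : ∀ n, MeasurableSet {x | p x n} := by
    intro n
    have : {x | p x n} = ({_x | 0 < n} ∩ ⋃ i ∈ Finset.range h, U i ∩ T^[n] ⁻¹' U i) ∪
        {_x | n = M * h + 1} := by
      ext x
      simp only [hp, mem_ofPred_eq, mem_union, mem_inter_iff, mem_iUnion, mem_preimage, exists_prop]
    rw [this]
    exact ((MeasurableSet.const _).inter (Finset.measurableSet_biUnion _ fun i _ =>
      (hUm i).inter ((hT.measurable.iterate n) (hUm i)))).union (MeasurableSet.const _)
  set k : ℝ → ℕ := fun x => Nat.find (hex x) with hk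
  have hkm : Measurable k := measurable_find hex hpm
  have hkspec : ∀ x, p x (k x) := fun x => Nat.find_spec (hex x)
  have hkmin : ∀ x n, p x n → k x ≤ n := fun x n hn => Nat.find_min' (hex x) hn
  have hkpos : ∀ x, 0 < k x := by
    intro x
    rcases hkspec x with h' | h'
    · exact h'.1
    · omega
  set B : Set ℝ := {x | ∃ j < M * h, ∃ q ∈ insert 1 P, |T^[j] x - q| < ρ} with hB
  set W : Set ℝ := ⋃ i ∈ Finset.range h, U i with hW
  set Z : Set ℝ := ⋃ n, T^[n] ⁻¹' P with hZ
  have hWm : MeasurableSet W := Finset.measurableSet_biUnion _ fun i _ => hUm i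
  have hBm : MeasurableSet B := by
    have : B = ⋃ j ∈ Finset.range (M * h), T^[j] ⁻¹' ⋃ q ∈ insert 1 P, Metric.ball q ρ := by
      ext x
      simp [hB, Real.dist_eq]
    rw [this]
    exact Finset.measurableSet_biUnion _ fun j _ => (hT.measurable.iterate j)
      (Finset.measurableSet_biUnion _ fun _ _ => measurableSet_ball)
  have hZm : MeasurableSet Z :=
    MeasurableSet.iUnion fun n => (hT.measurable.iterate n) (Finset.measurableSet _)
  have hZ0 : leb01 Z = 0 := by
    refine measure_mono_null ?_ (hT.ae_iterate_notMem P)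
    intro x hx hx'
    obtain ⟨n, hn⟩ := mem_iUnion.1 hx
    exact hx' n hn
  set E : Set ℝ := (W ∩ {x | k x ≤ M * h}) \ (B ∪ Z) with hE
  have hEm : MeasurableSet E :=
    (hWm.inter (hkm measurableSet_Iic)).diff (hBm.union hZm)
  have hWsub : W ⊆ Ico 0 1 := by
    intro x hx
    obtain ⟨i, hi, hxi⟩ := mem_iUnion₂.1 hx
    exact hK.level_subset hT (Finset.mem_range.1 hi) hxi
  have hEsub : E ⊆ Ico 0 1 := fun x hx => hWsub hx.1.1
  have hEret : ∀ x ∈ E, ∃ i < h, x ∈ U i ∧ T^[k x] x ∈ U i := by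
    intro x hx
    rcases hkspec x with ⟨-, i, hi, h'⟩ | h'
    · exact ⟨i, Finset.mem_range.1 hi, h'⟩
    · have : k x ≤ M * h := hx.1.2
      omega
  have hEP : ∀ x ∈ E, ∀ n, T^[n] x ∉ P := fun x hx n hn =>
    hx.2 (Or.inr (mem_iUnion.2 ⟨n, hn⟩))
  refine ⟨E, k, hEm, hEsub, hkm, ?_, fun x hx => ⟨?_, hx.1.2⟩, ?_, ?_, ?_⟩
  · set V : ℕ → Set ℝ := fun i =>
      {x | x ∈ U i ∧ ∀ m, 0 < m → m ≤ M * h → T^[m] x ∉ U i} with hV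
    have hcov : W ⊆ (E ∪ Z) ∪ ((⋃ i ∈ Finset.range h, V i) ∪ B) := by
      intro x hx
      by_cases hxB : x ∈ B
      · exact Or.inr (Or.inr hxB)
      by_cases hxZ : x ∈ Z
      · exact Or.inl (Or.inr hxZ)
      by_cases hxk : k x ≤ M * h
      · exact Or.inl (Or.inl ⟨⟨hx, hxk⟩, fun h' => h'.elim hxB hxZ⟩)
      obtain ⟨i, hi, hxi⟩ := mem_iUnion₂.1 hx
      refine Or.inr (Or.inl (mem_iUnion₂.2 ⟨i, hi, hxi, fun m h1 h2 h3 => hxk ?_⟩))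
      exact (hkmin x m (Or.inl ⟨h1, i, hi, hxi, h3⟩)).trans h2
    have hWmeas : leb01.real W = h * (b - a) := by
      have hd : (Finset.range h : Set ℕ).PairwiseDisjoint U := by
        intro i hi j hj hij
        refine disjoint_left.2 fun x hx hx' => hij ?_
        exact hK.level_unique hT (Finset.mem_range.1 (Finset.mem_coe.1 hi))
          (Finset.mem_range.1 (Finset.mem_coe.1 hj)) hx hx'
      rw [Measure.real, hW, measure_biUnion_finset hd fun i _ => hUm i,
        Finset.sum_congr rfl fun i hi => hK.leb01_level hT (Finset.mem_range.1 hi),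
        Finset.sum_const, Finset.card_range, nsmul_eq_mul, ENNReal.toReal_mul,
        ENNReal.toReal_natCast, ENNReal.toReal_ofReal (by linarith [hK.lt])]
    have hMh : (0 : ℝ) < M * h := by
      have := hK.height_pos
      positivity
    have hVmeas : leb01.real (⋃ i ∈ Finset.range h, V i) ≤ 1 / M := by
      have h1 : ∀ i, leb01.real (V i) ≤ 1 / (M * h) := by
        intro i
        have h2 := ENNReal.toReal_mono ENNReal.one_ne_top
          (hT.measure_no_return_le (hUm i) (M * h))
        rw [ENNReal.toReal_mul, ENNReal.toReal_natCast, ENNReal.toReal_one] at h2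
        push_cast at h2
        change (M * h + 1) * leb01.real (V i) ≤ 1 at h2
        rw [le_div_iff₀ hMh]
        nlinarith [measureReal_nonneg (μ := leb01) (s := V i)]
      refine (measureReal_biUnion_finset_le _ _).trans ?_
      refine (Finset.sum_le_card_nsmul _ _ _ fun i _ => h1 i).trans_eq ?_
      have : (h : ℝ) ≠ 0 := fun h0 => by simp [h0] at hMh
      rw [Finset.card_range, nsmul_eq_mul]
      field_simp
    have hBmeas : leb01.real B ≤ M * h * ((P.card + 1) * (2 * ρ)) := by
      have h1 := ENNReal.toReal_mono (by finiteness) (hT.measure_near_le (insert 1 P) (M * h) ρ)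
      rw [ENNReal.toReal_mul, ENNReal.toReal_mul, ENNReal.toReal_natCast, ENNReal.toReal_natCast,
        ENNReal.toReal_ofReal (by linarith)] at h1
      push_cast at h1
      refine h1.trans ?_
      have : ((insert 1 P).card : ℝ) ≤ P.card + 1 := by exact_mod_cast Finset.card_insert_le _ _
      gcongr
    have hZr : leb01.real Z = 0 := by rw [Measure.real, hZ0, ENNReal.toReal_zero]
    have h1 := measureReal_mono (μ := leb01) hcov
    have h2 := measureReal_union_le (μ := leb01) (E ∪ Z) ((⋃ i ∈ Finset.range h, V i) ∪ B)
    have h3 := measureReal_union_le (μ := leb01) E Z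
    have h4 := measureReal_union_le (μ := leb01) (⋃ i ∈ Finset.range h, V i) B
    linarith
  · obtain ⟨i, hi, hxi, hki⟩ := hEret x hx
    exact hK.height_le_of_return hT hi (hkpos x) hxi hki
  · intro x hx u hu j hj
    refine hT.iterate_add_of_far (n := M * h) (hEsub hx) (fun j hj q hq => ?_) hu j
      (hj.trans hx.1.2)
    by_contra! hcon
    exact hx.2 (Or.inl ⟨j, hj, q, hq, hcon⟩)
  · intro x hx
    obtain ⟨i, hi, hxi, hki⟩ := hEret x hx
    have h1 := hT.abs_sum_le (hEsub hx)
      (fun j _ h0 => hEP x hx j (h0 ▸ hT.zero_mem)) (by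
        rw [hK.leb01_level hT hi, Ne, ENNReal.ofReal_eq_zero]
        linarith [hK.lt]) hxi hki
      (hK.sum_visits_le (M := M) hT hi hx.1.2 (hEsub hx) (hEP x hx))
    push_cast at h1
    linarith
  · have aux : ∀ x ∈ E, ∀ y ∈ E, k x ≤ k y → T^[k x] x = T^[k y] y → x = y := by
      intro x hx y hy hxy heq
      obtain ⟨i, hi, hxi, hki⟩ := hEret x hx
      obtain ⟨j, hj, hyj, hkj⟩ := hEret y hy
      have hij : i = j := hK.level_unique hT hi hj (heq ▸ hki) hkj
      obtain ⟨d, hd⟩ := Nat.exists_eq_add_of_le hxy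
      rw [hd, Function.iterate_add_apply] at heq
      have hxd := hT.iterate_injOn _ (hEsub hx) (hT.iterate_mem (hEsub hy) d) heq
      rcases Nat.eq_zero_or_pos d with rfl | hd0
      · exact hxd
      · have h1 := hkmin y d (Or.inl ⟨hd0, j, Finset.mem_range.2 hj, hyj, hxd ▸ hij ▸ hxi⟩)
        have h2 := hkpos x
        omega
    intro x hx y hy hxy
    rcases le_total (k x) (k y) with h' | h'
    · exact aux x hx y hy h' hxy
    · exact (aux y hy x hx h' hxy.symm).symm

end IntervalTower

namespace SymmIET

variable {T : ℝ → ℝ} {P : Finset ℝ}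

/-- On a set of measure bounded from below, points return close to themselves after a time `k`
comparable to `h`, the dynamics being a translation at scale `1 / h` up to time `k`, with bounded
Birkhoff sums of `x - 1/2`. -/
theorem exists_returns (hT : SymmIET T P) :
    ∃ (c κ : ℝ) (M : ℕ), 0 < c ∧ 0 < κ ∧ ∀ η > 0,
      ∃ (h : ℕ) (E : Set ℝ) (k : ℝ → ℕ), 0 < h ∧ κ / h ≤ η ∧ MeasurableSet E ∧ E ⊆ Ico 0 1 ∧
        Measurable k ∧ c ≤ leb01.real E ∧
        (∀ x ∈ E, h ≤ k x ∧ k x ≤ M * h) ∧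
        (∀ x ∈ E, ∀ u, |u| < κ / h → ∀ j ≤ k x, T^[j] (x + u) = T^[j] x + u) ∧
        (∀ x ∈ E, |∑ j ∈ Finset.range (k x), (T^[j] x - 1 / 2)| ≤ 4 * M + 1) ∧
        InjOn (fun x => T^[k x] x) E := by
  set N : ℕ := 2 * P.card + 2 with hN
  have hN0 : (0 : ℝ) < N := by positivity
  have hP0 : (0 : ℝ) < P.card + 1 := by positivity
  set κ : ℝ := 1 / (8 * N * (4 * N) * (P.card + 1)) with hκ
  have hκ0 : 0 < κ := by positivity
  refine ⟨1 / (2 * N), κ, 4 * N, by positivity, hκ0, fun η hη => ?_⟩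
  obtain ⟨ℓ, hℓ0, hℓ⟩ := exists_between (lt_min one_pos (show 0 < η / (κ * N) by positivity))
  obtain ⟨a, b, h, t, ha, hab, hbℓ, hh, h1, h2, h3⟩ :=
    hT.exists_tower hℓ0 (hℓ.trans_le (min_le_left _ _))
  have hK : IntervalTower T a b h t :=
    ⟨ha, hab, hbℓ.trans (hℓ.trans_le (min_le_left _ _)).le, hh, h1, h2⟩
  have hh' : (0 : ℝ) < h := by exact_mod_cast hh
  obtain ⟨E, k, e1, e2, e3, e4, e5, e6, e7, e8⟩ :=
    hK.exists_returns hT (M := 4 * N) (by omega) (ρ := κ / h) (by positivity)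
  refine ⟨h, E, k, hh, ?_, e1, e2, e3, ?_, e5, e6, e7, e8⟩
  · have h4 : ℓ * (κ * N) < η := by
      rw [← lt_div_iff₀ (by positivity)]
      exact hℓ.trans_le (min_le_right _ _)
    have h5 : (1 : ℝ) ≤ N * (h * ℓ) := by
      refine h3.trans ?_
      gcongr
      linarith
    rw [div_le_iff₀ hh']
    nlinarith [mul_le_mul_of_nonneg_left h5 hκ0.le]
  · refine le_trans ?_ e4
    have h6 : (1 : ℝ) / N ≤ h * (b - a) := by
      rw [div_le_iff₀ hN0]
      linarith
    have h7 : ((4 * N : ℕ) : ℝ) * h * ((P.card + 1) * (2 * (κ / h))) = 1 / (4 * N) := by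
      rw [hκ]
      push_cast
      field_simp
      norm_num
    rw [h7]
    push_cast
    have h8 : 1 / (2 * (N : ℝ)) = 1 / N - 1 / (4 * N) - 1 / (4 * N) := by
      field_simp
      norm_num
    linarith

end SymmIET

lemma lintegral_edist_translate_le {g : ℝ × ℝ → ℝ} (hg : Measurable g) (hg1 : ∀ p, |g p| ≤ 1)
    {R : ℝ} (hR : 0 ≤ R) {ε : ℝ} (hε : 0 < ε) :
    ∃ η > 0, ∀ u : ℝ, |u| < η → ∫⁻ p, edist (g (p.1 + u, p.2)) (g p)
      ∂(leb01.prod (volume.restrict (Icc (-R) R))) ≤ ENNReal.ofReal ε := by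
  set K : Set (ℝ × ℝ) := Icc (-1) 2 ×ˢ Icc (-R) R with hK
  have hKm : MeasurableSet K := measurableSet_Icc.prod measurableSet_Icc
  set ν : Measure (ℝ × ℝ) := leb01.prod (volume.restrict (Icc (-R) R)) with hν
  have hνeq : ν = volume.restrict (Ico (0 : ℝ) 1 ×ˢ Icc (-R) R) := by
    rw [hν, Measure.prod_restrict]; rfl
  have hνle : ν ≤ volume := by rw [hνeq]; exact Measure.restrict_le_self
  have hνuniv : ν univ = ENNReal.ofReal (2 * R) := by
    rw [hν, Measure.prod_apply MeasurableSet.univ]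
    simp only [preimage_univ, Measure.restrict_apply_univ, Real.volume_Icc, lintegral_const,
      Real.volume_Ico]
    rw [sub_zero, ENNReal.ofReal_one, mul_one]
    congr 1; ring
  have hG : Integrable (K.indicator g) := by
    rw [integrable_indicator_iff hKm]
    refine Measure.integrableOn_of_bounded (M := 1) ?_ hg.aestronglyMeasurable
      (ae_of_all _ fun p => by simpa using hg1 p)
    exact ((isCompact_Icc.prod isCompact_Icc).measure_lt_top).ne
  obtain ⟨φ, hφc, hφ, hφcont, -⟩ := hG.exists_hasCompactSupport_lintegral_sub_le
    (ε := ENNReal.ofReal (ε / 4)) (by simpa using hε)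
  obtain ⟨η, hη, hηφ⟩ := Metric.uniformContinuous_iff.1
    (hφc.uniformContinuous_of_continuous hφcont) (ε / (2 * (2 * R + 1))) (by positivity)
  refine ⟨min η 1, by positivity, fun u hu => ?_⟩
  have hu1 : |u| < 1 := hu.trans_le (min_le_right _ _)
  set τ : ℝ × ℝ := (u, 0)
  have hm : Measurable fun p => ‖K.indicator g p - φ p‖ₑ :=
    ((hg.indicator hKm).sub hφcont.measurable).enorm
  have hpt : ∀ᵐ p ∂ν, edist (g (p.1 + u, p.2)) (g p) ≤
      ‖K.indicator g (p + τ) - φ (p + τ)‖ₑ + ENNReal.ofReal (ε / (2 * (2 * R + 1)))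
        + ‖K.indicator g p - φ p‖ₑ := by
    rw [hνeq]
    refine (ae_restrict_mem (measurableSet_Ico.prod measurableSet_Icc)).mono fun p hp => ?_
    have hu' := abs_lt.1 hu1
    have hpK : p ∈ K := ⟨⟨by linarith [hp.1.1], by linarith [hp.1.2]⟩, hp.2⟩
    have hpK' : (p.1 + u, p.2) ∈ K :=
      ⟨⟨by simp only; linarith [hp.1.1], by simp only; linarith [hp.1.2]⟩, hp.2⟩
    have h1 : K.indicator g p = g p := indicator_of_mem hpK _
    have h2 : K.indicator g (p + τ) = g (p.1 + u, p.2) := by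
      have : p + τ = (p.1 + u, p.2) := by simp [τ, Prod.ext_iff]
      rw [this]
      exact indicator_of_mem hpK' _
    rw [h1, h2, ← edist_eq_enorm_sub, ← edist_eq_enorm_sub]
    calc edist (g (p.1 + u, p.2)) (g p)
        ≤ edist (g (p.1 + u, p.2)) (φ (p + τ)) + edist (φ (p + τ)) (φ p)
          + edist (φ p) (g p) := edist_triangle4 _ _ _ _
      _ ≤ _ := by
        rw [edist_comm (φ p)]
        gcongr
        rw [edist_dist]
        refine ENNReal.ofReal_le_ofReal (hηφ ?_).le
        rw [dist_eq_norm, add_sub_cancel_left, Prod.norm_def]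
        simpa [τ] using hu.trans_le (min_le_left _ _)
  have hφ' : ∫⁻ p, ‖K.indicator g p - φ p‖ₑ ∂ν ≤ ENNReal.ofReal (ε / 4) :=
    (lintegral_mono' hνle le_rfl).trans hφ
  have hφτ : ∫⁻ p, ‖K.indicator g (p + τ) - φ (p + τ)‖ₑ ∂ν ≤ ENNReal.ofReal (ε / 4) := by
    refine (lintegral_mono' hνle le_rfl).trans ?_
    rwa [lintegral_add_right_eq_self (fun p => ‖K.indicator g p - φ p‖ₑ) τ]
  calc _ ≤ _ := lintegral_mono_ae hpt
    _ ≤ ENNReal.ofReal (ε / 4) + ENNReal.ofReal (ε / (2 * (2 * R + 1))) * ENNReal.ofReal (2 * R)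
        + ENNReal.ofReal (ε / 4) := by
      rw [lintegral_add_right _ hm, lintegral_add_right _ measurable_const, lintegral_const, hνuniv]
      gcongr
    _ ≤ ENNReal.ofReal ε := by
      rw [← ENNReal.ofReal_mul (by positivity), ← ENNReal.ofReal_add (by positivity) (by positivity),
        ← ENNReal.ofReal_add (by positivity) (by positivity)]
      apply ENNReal.ofReal_le_ofReal
      have : ε / (2 * (2 * R + 1)) * (2 * R) ≤ ε / 2 := by
        rw [div_mul_eq_mul_div, div_le_div_iff₀ (by positivity) (by positivity)]
        nlinarith
      linarith

/-- A set almost invariant under almost all small translations is null or conull. -/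
lemma null_or_conull_of_ae_translate {B : Set ℝ} (hB : MeasurableSet B) {s₀ : ℝ} (hs₀ : 0 < s₀)
    (h : ∀ᵐ s ∂(volume.restrict (Ioo 0 s₀)), ∀ᵐ r, r + s ∈ B ↔ r ∈ B) :
    volume B = 0 ∨ volume Bᶜ = 0 := by
  set H : AddSubgroup ℝ :=
    { carrier := {s | ∀ᵐ r, r + s ∈ B ↔ r ∈ B}
      zero_mem' := by simp
      add_mem' := by
        intro s t hs ht
        have hs' : ∀ᵐ r, r + t + s ∈ B ↔ r + t ∈ B :=
          (measurePreserving_add_right volume t).quasiMeasurePreserving.ae hs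
        change ∀ᵐ r, r + (s + t) ∈ B ↔ r ∈ B
        filter_upwards [hs', ht] with r h1 h2
        rw [add_comm s t, ← add_assoc, h1, h2]
      neg_mem' := by
        intro s hs
        have hs' : ∀ᵐ r, r + -s + s ∈ B ↔ r + -s ∈ B :=
          (measurePreserving_add_right volume (-s)).quasiMeasurePreserving.ae hs
        change ∀ᵐ r, r + -s ∈ B ↔ r ∈ B
        filter_upwards [hs'] with r h1
        rw [← h1, neg_add_cancel_right] } with hH
  have hae : ∀ᵐ s, s ∈ Ioo 0 s₀ → s ∈ H := (ae_restrict_iff' measurableSet_Ioo).1 h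
  have hIoo : ∀ s ∈ Ioo 0 s₀, s ∈ H := by
    intro s hs
    have h2 : ∀ᵐ t, s - t ∈ Ioo 0 s₀ → s - t ∈ H :=
      (Measure.measurePreserving_sub_left volume s).quasiMeasurePreserving.ae hae
    have h3 : ∀ᵐ t ∂(volume.restrict (Ioo 0 s)), t ∈ H ∧ s - t ∈ H := by
      rw [ae_restrict_iff' measurableSet_Ioo]
      filter_upwards [hae, h2] with t ht ht' hts
      exact ⟨ht ⟨hts.1, hts.2.trans hs.2⟩, ht' ⟨by linarith [hts.2], by linarith [hts.1, hs.2]⟩⟩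
    have : (ae (volume.restrict (Ioo 0 s))).NeBot := by
      rw [ae_neBot, Ne, Measure.restrict_eq_zero]
      simpa using hs.1
    obtain ⟨t, ht⟩ := h3.exists
    simpa using H.add_mem ht.1 ht.2
  have hpos : ∀ s : ℝ, 0 < s → s ∈ H := by
    intro s hs
    obtain ⟨n, hn⟩ := exists_nat_gt (s / s₀)
    have hn0 : (0 : ℝ) < n := (div_pos hs hs₀).trans hn
    have : s / n ∈ H := hIoo _ ⟨by positivity, by
      rw [div_lt_iff₀ hn0]; rwa [div_lt_iff₀ hs₀, mul_comm] at hn⟩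
    have h2 := H.nsmul_mem this n
    rwa [nsmul_eq_mul, mul_div_cancel₀ _ hn0.ne'] at h2
  have hall : ∀ s, ∀ᵐ r, r + s ∈ B ↔ r ∈ B := by
    intro s
    change s ∈ H
    rcases lt_trichotomy s 0 with hs | hs | hs
    · simpa using H.neg_mem (hpos (-s) (by linarith))
    · exact hs ▸ H.zero_mem
    · exact hpos s hs
  have hm : MeasurableSet {p : ℝ × ℝ | p.2 + p.1 ∈ B ↔ p.2 ∈ B} :=
    ((measurable_snd.add measurable_fst) hB).iff (measurable_snd hB)
  have hsw : ∀ᵐ r, ∀ᵐ s, r + s ∈ B ↔ r ∈ B :=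
    (Measure.ae_ae_comm (p := fun s r : ℝ => r + s ∈ B ↔ r ∈ B) hm).1 (ae_of_all _ hall)
  obtain ⟨r, hr⟩ := hsw.exists
  have hr' : ∀ᵐ s, s ∈ B ↔ r ∈ B := by
    have := (measurePreserving_sub_right volume r).quasiMeasurePreserving.ae hr
    simpa using this
  by_cases hrB : r ∈ B
  · right; simpa [hrB, ae_iff, compl_def] using hr'
  · left; simpa [hrB, ae_iff] using hr'

/-- The mean oscillation of `g` over `{x} × [-R, R]` under fibre translations by `s ∈ (0, s₀)`. -/
noncomputable def fiberOsc (g : ℝ × ℝ → ℝ) (s₀ R x : ℝ) : ENNReal :=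
  ∫⁻ s in Ioo 0 s₀, ∫⁻ r in Icc (-R) R, edist (g (x, r + s)) (g (x, r))

/-- The mean oscillation of `g` over `{x} × [-R, R]` under the base translation by `u`. -/
noncomputable def baseOsc (g : ℝ × ℝ → ℝ) (R x u : ℝ) : ENNReal :=
  ∫⁻ r in Icc (-R) R, edist (g (x + u, r)) (g (x, r))

lemma measurable_fiberOsc {g : ℝ × ℝ → ℝ} (hg : Measurable g) (s₀ R : ℝ) :
    Measurable (fiberOsc g s₀ R) := by
  unfold fiberOsc
  apply Measurable.lintegral_prod_right
  apply Measurable.lintegral_prod_right (f := fun p : ℝ × ℝ => fun r =>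
    edist (g (p.1, r + p.2)) (g (p.1, r)))
  fun_prop

lemma measurable_baseOsc {g : ℝ × ℝ → ℝ} (hg : Measurable g) (R : ℝ) :
    Measurable fun p : ℝ × ℝ => baseOsc g R p.1 p.2 := by
  unfold baseOsc
  apply Measurable.lintegral_prod_right (f := fun p : ℝ × ℝ => fun r =>
    edist (g (p.1 + p.2, r)) (g (p.1, r)))
  fun_prop

lemma fiberOsc_mono (g : ℝ × ℝ → ℝ) (s₀ : ℝ) {R R' : ℝ} (h : R ≤ R') (x : ℝ) :
    fiberOsc g s₀ R x ≤ fiberOsc g s₀ R' x :=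
  lintegral_mono fun _ => lintegral_mono_set (Icc_subset_Icc (by linarith) h)

lemma setLIntegral_comp_mul_le {F : ℝ → ENNReal} (hF : Measurable F) {c s₀ ρ : ℝ} (hc : c ≠ 0)
    (h : |c| * s₀ ≤ ρ) :
    ∫⁻ s in Ioo 0 s₀, F (c * s) ≤ ENNReal.ofReal |c⁻¹| * ∫⁻ u in Ioo (-ρ) ρ, F u := by
  have hsub : Ioo 0 s₀ ⊆ (c * ·) ⁻¹' Ioo (-ρ) ρ := fun s hs => by
    rw [mem_preimage, mem_Ioo, ← abs_lt, abs_mul, abs_of_pos hs.1]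
    exact (mul_lt_mul_of_pos_left hs.2 (abs_pos.2 hc)).trans_le h
  refine (lintegral_mono_set hsub).trans ?_
  rw [← setLIntegral_map measurableSet_Ioo hF (by fun_prop), Real.map_volume_mul_left hc,
    Measure.restrict_smul, lintegral_smul_measure, smul_eq_mul]

lemma setLIntegral_comp_add_le {F : ℝ → ENNReal} (hF : Measurable F) {R R' c : ℝ}
    (h : R + |c| ≤ R') :
    ∫⁻ r in Icc (-R) R, F (r + c) ≤ ∫⁻ r in Icc (-R') R', F r := by
  have hsub : Icc (-R) R ⊆ (· + c) ⁻¹' Icc (-R') R' := fun r hr =>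
    ⟨by simp only; linarith [hr.1, neg_abs_le c], by simp only; linarith [hr.2, le_abs_self c]⟩
  refine (lintegral_mono_set hsub).trans_eq ?_
  exact (measurePreserving_add_right volume c).setLIntegral_comp_preimage measurableSet_Icc hF

section

variable {T : ℝ → ℝ} {a : ℝ} {g : ℝ × ℝ → ℝ}

lemma apply_iterate_of_invariant (hinv : ∀ x r, g (T x, r + a * (x - 1 / 2)) = g (x, r))
    (n : ℕ) (x r : ℝ) :
    g (T^[n] x, r + a * ∑ j ∈ Finset.range n, (T^[j] x - 1 / 2)) = g (x, r) := by
  induction n with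
  | zero => simp
  | succ n ih =>
    rw [Function.iterate_succ_apply', Finset.sum_range_succ, mul_add, ← add_assoc, hinv, ih]

/-- Comparing the orbits of `x` and `x + u` up to a near return turns a small base translation into a
fibre translation by `a * k * u`. -/
lemma fiberOsc_le (hg : Measurable g)
    (hinv : ∀ x r, g (T x, r + a * (x - 1 / 2)) = g (x, r)) (ha : a ≠ 0) {κ ρ C R R' x : ℝ} {k : ℕ}
    (hk : 0 < k) (hρ : κ / k ≤ ρ)
    (hadd : ∀ u, |u| < ρ → ∀ j ≤ k, T^[j] (x + u) = T^[j] x + u)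
    (hC : |∑ j ∈ Finset.range k, (T^[j] x - 1 / 2)| ≤ C)
    (hR' : R + |a| * (C + κ) ≤ R') :
    fiberOsc g (|a| * κ) R x ≤ ENNReal.ofReal (|a| * k) *
      ((∫⁻ u in Ioo (-ρ) ρ, baseOsc g R' x u) + ∫⁻ u in Ioo (-ρ) ρ, baseOsc g R' (T^[k] x) u) := by
  have hk' : (0 : ℝ) < k := Nat.cast_pos.2 hk
  have ha' : 0 < |a| := abs_pos.2 ha
  set y := T^[k] x
  set S := ∑ j ∈ Finset.range k, (T^[j] x - 1 / 2) with hS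
  set c : ℝ := (a * k)⁻¹ with hc
  have hc0 : c ≠ 0 := by positivity
  have hcabs : |c| = (|a| * k)⁻¹ := by rw [hc, abs_inv, abs_mul, abs_of_pos hk']
  have hcs : |c| * (|a| * κ) ≤ ρ := by
    rw [hcabs]
    refine le_trans (le_of_eq ?_) hρ
    field_simp
  have hmeas : ∀ z, Measurable (baseOsc g R' z) := fun z =>
    (measurable_baseOsc hg R').comp measurable_prodMk_left
  have key : ∀ s ∈ Ioo 0 (|a| * κ), ∫⁻ r in Icc (-R) R, edist (g (x, r + s)) (g (x, r)) ≤
      baseOsc g R' x (c * s) + baseOsc g R' y (c * s) := by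
    intro s hs
    set u := c * s with hu
    have hκ : 0 < κ := by
      have := hs.1.trans hs.2
      exact pos_of_mul_pos_right this ha'.le
    have huρ : |u| < ρ := by
      rw [hu, abs_mul, abs_of_pos hs.1]
      exact (mul_lt_mul_of_pos_left hs.2 (abs_pos.2 hc0)).trans_le hcs
    have hxu : ∀ r, g (y + u, r + (a * S + s)) = g (x + u, r) := by
      intro r
      rw [← apply_iterate_of_invariant hinv k (x + u) r, hadd u huρ k le_rfl]
      congr 3
      have : ∑ j ∈ Finset.range k, (T^[j] (x + u) - 1 / 2) = S + k * u := by
        rw [Finset.sum_congr rfl fun j hj => by rw [hadd u huρ j (Finset.mem_range.1 hj).le]]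
        simp only [hS, Finset.sum_sub_distrib, Finset.sum_add_distrib, Finset.sum_const,
          Finset.card_range, nsmul_eq_mul]
        ring
      rw [this, hu, hc]
      field_simp
    have hxs : ∀ r, g (y, r + (a * S + s)) = g (x, r + s) := by
      intro r
      rw [← apply_iterate_of_invariant hinv k x (r + s)]
      congr 2
      ring
    have hcs : |a * S + s| ≤ |a| * (C + κ) := by
      refine (abs_add_le _ _).trans ?_
      rw [abs_mul, abs_of_pos hs.1]
      nlinarith [hs.2]
    calc ∫⁻ r in Icc (-R) R, edist (g (x, r + s)) (g (x, r))
        ≤ ∫⁻ r in Icc (-R) R, (edist (g (x + u, r)) (g (x, r)) +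
            edist (g (y + u, r + (a * S + s))) (g (y, r + (a * S + s)))) := by
          refine lintegral_mono fun r => ?_
          rw [hxu, hxs, add_comm (edist _ _), edist_comm (g (x + u, r)) (g (x, r + s))]
          exact edist_triangle _ _ _
      _ = _ := lintegral_add_left (by fun_prop) _
      _ ≤ _ := by
        refine add_le_add (lintegral_mono_set (Icc_subset_Icc ?_ ?_)) ?_
        · linarith [abs_nonneg (a * S + s)]
        · linarith [abs_nonneg (a * S + s)]
        · exact setLIntegral_comp_add_le (F := fun r => edist (g (y + u, r)) (g (y, r)))
            (by fun_prop) (by linarith)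
  calc fiberOsc g (|a| * κ) R x
      ≤ ∫⁻ s in Ioo 0 (|a| * κ), (baseOsc g R' x (c * s) + baseOsc g R' y (c * s)) :=
        setLIntegral_mono' measurableSet_Ioo key
    _ = _ := lintegral_add_left ((hmeas x).comp (by fun_prop)) _
    _ ≤ _ := add_le_add (setLIntegral_comp_mul_le (hmeas x) hc0 hcs)
        (setLIntegral_comp_mul_le (hmeas y) hc0 hcs)
    _ = _ := by
      rw [abs_inv, hcabs, inv_inv, mul_add]

end

namespace SymmIET

variable {T : ℝ → ℝ} {P : Finset ℝ}

lemma exists_fiberOsc_small (hT : SymmIET T P) {a : ℝ} (ha : a ≠ 0) :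
    ∃ s₀ > 0, ∃ c > 0, ∀ g : ℝ × ℝ → ℝ, Measurable g → (∀ p, |g p| ≤ 1) →
      (∀ x r, g (T x, r + a * (x - 1 / 2)) = g (x, r)) → ∀ R ≥ 0, ∀ ε > 0,
        ENNReal.ofReal c ≤ leb01 {x | fiberOsc g s₀ R x ≤ ENNReal.ofReal ε} := by
  obtain ⟨c, κ, M, hc, hκ, hret⟩ := hT.exists_returns
  have ha' : 0 < |a| := abs_pos.2 ha
  refine ⟨|a| * κ, by positivity, c / 2, by positivity, fun g hg hg1 hinv R hR ε hε => ?_⟩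
  set R' := R + |a| * (4 * M + 1 + κ) with hR'
  set D : ℝ := |a| * M * κ with hD
  have hD0 : 0 ≤ D := by positivity
  set δ := ε * c / (8 * (D + 1)) with hδ
  obtain ⟨η, hη, hηg⟩ := lintegral_edist_translate_le hg hg1 (R := R') (by positivity)
    (ε := δ) (by positivity)
  obtain ⟨h, E, k, hh, hκη, hE, hEs, hk, hcE, hkh, hadd, hS, hinj⟩ := hret η hη
  have hh' : (0 : ℝ) < h := Nat.cast_pos.2 hh
  set ρ := κ / h with hρ
  have hρ0 : 0 < ρ := by positivity
  set β : ℝ → ENNReal := fun x => ∫⁻ u in Ioo (-ρ) ρ, baseOsc g R' x u with hβ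
  have hbm := measurable_baseOsc hg R'
  have hβm : Measurable β := Measurable.lintegral_prod_right hbm
  have hβint : ∫⁻ x, β x ∂leb01 ≤ ENNReal.ofReal (δ * (2 * ρ)) := by
    rw [hβ, lintegral_lintegral_swap hbm.aemeasurable]
    calc ∫⁻ u in Ioo (-ρ) ρ, ∫⁻ x, baseOsc g R' x u ∂leb01
        ≤ ∫⁻ _ in Ioo (-ρ) ρ, ENNReal.ofReal δ := by
          refine setLIntegral_mono' measurableSet_Ioo fun u hu => ?_
          refine le_trans (le_of_eq ?_) (hηg u ((abs_lt.2 hu).trans_le hκη))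
          rw [lintegral_prod _ (by fun_prop)]
          rfl
      _ = _ := by
        rw [setLIntegral_const, Real.volume_Ioo, ← ENNReal.ofReal_mul (by positivity)]
        congr 2; ring
  have hle : ∀ x ∈ E, fiberOsc g (|a| * κ) R x ≤
      ENNReal.ofReal (|a| * (M * h)) * (β x + β (T^[k x] x)) := by
    intro x hx
    obtain ⟨hk1, hk2⟩ := hkh x hx
    have hk1' : (h : ℝ) ≤ k x := by exact_mod_cast hk1
    have hk2' : (k x : ℝ) ≤ M * h := by exact_mod_cast hk2
    refine (fiberOsc_le hg hinv ha (hh.trans_le hk1) (div_le_div_of_nonneg_left hκ.le hh' hk1')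
      (hadd x hx) (hS x hx) le_rfl).trans ?_
    gcongr
  have hint : ∫⁻ x in E, fiberOsc g (|a| * κ) R x ∂leb01 ≤ ENNReal.ofReal (ε * (c / 2)) := by
    calc ∫⁻ x in E, fiberOsc g (|a| * κ) R x ∂leb01
        ≤ ∫⁻ x in E, ENNReal.ofReal (|a| * (M * h)) * (β x + β (T^[k x] x)) ∂leb01 :=
          setLIntegral_mono' hE hle
      _ = ENNReal.ofReal (|a| * (M * h)) *
          ((∫⁻ x in E, β x ∂leb01) + ∫⁻ x in E, β (T^[k x] x) ∂leb01) := by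
        rw [lintegral_const_mul' _ _ ENNReal.ofReal_ne_top, lintegral_add_left hβm]
      _ ≤ ENNReal.ofReal (|a| * (M * h)) *
          (ENNReal.ofReal (δ * (2 * ρ)) + ENNReal.ofReal (δ * (2 * ρ))) := by
        gcongr
        · exact (setLIntegral_le_lintegral _ _).trans hβint
        · exact (hT.lintegral_comp_iterate_le hE hEs hk hinj hβm).trans hβint
      _ ≤ _ := by
        rw [← ENNReal.ofReal_add (by positivity) (by positivity),
          ← ENNReal.ofReal_mul (by positivity)]
        apply ENNReal.ofReal_le_ofReal
        have : |a| * (M * h) * (δ * (2 * ρ) + δ * (2 * ρ)) = 4 * D * δ := by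
          rw [hρ, hD]; field_simp; ring
        rw [this, hδ, mul_div_assoc', div_le_iff₀ (by positivity)]
        nlinarith [mul_pos hε hc]
  have hmarkov : leb01 (E ∩ {x | ENNReal.ofReal ε ≤ fiberOsc g (|a| * κ) R x}) ≤
      ENNReal.ofReal (c / 2) := by
    have h1 := (mul_meas_ge_le_lintegral (μ := leb01.restrict E)
      (measurable_fiberOsc hg (|a| * κ) R) (ENNReal.ofReal ε)).trans hint
    rw [ENNReal.ofReal_mul hε.le, ENNReal.mul_le_mul_iff_right (by simpa using hε)
      ENNReal.ofReal_ne_top] at h1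
    rwa [Measure.restrict_apply' hE, inter_comm] at h1
  have hcov : E ⊆ (E ∩ {x | ENNReal.ofReal ε ≤ fiberOsc g (|a| * κ) R x}) ∪
      {x | fiberOsc g (|a| * κ) R x ≤ ENNReal.ofReal ε} := fun x hx =>
    (le_total (ENNReal.ofReal ε) (fiberOsc g (|a| * κ) R x)).imp (fun h => ⟨hx, h⟩) id
  have h2 : ENNReal.ofReal c ≤ ENNReal.ofReal (c / 2) +
      leb01 {x | fiberOsc g (|a| * κ) R x ≤ ENNReal.ofReal ε} :=
    calc ENNReal.ofReal c ≤ leb01 E := ENNReal.ofReal_le_of_le_toReal hcE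
      _ ≤ _ := (measure_mono hcov).trans (measure_union_le _ _)
      _ ≤ _ := by gcongr
  have h3 : ENNReal.ofReal c = ENNReal.ofReal (c / 2) + ENNReal.ofReal (c / 2) := by
    rw [← ENNReal.ofReal_add (by positivity) (by positivity), add_halves]
  rw [h3] at h2
  exact (ENNReal.add_le_add_iff_left ENNReal.ofReal_ne_top).1 h2

lemma exists_fiber_translates (hT : SymmIET T P) {a : ℝ} (ha : a ≠ 0) :
    ∃ s₀ > 0, ∀ g : ℝ × ℝ → ℝ, Measurable g → (∀ p, |g p| ≤ 1) →
      (∀ x r, g (T x, r + a * (x - 1 / 2)) = g (x, r)) →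
        leb01 {x | ∀ᵐ s ∂(volume.restrict (Ioo 0 s₀)), ∀ᵐ r, g (x, r + s) = g (x, r)} ≠ 0 := by
  obtain ⟨s₀, hs₀, c, hc, hsmall⟩ := hT.exists_fiberOsc_small ha
  refine ⟨s₀, hs₀, fun g hg hg1 hinv => ?_⟩
  set B : ℕ → Set ℝ := fun n => {x | fiberOsc g s₀ n x ≤ ENNReal.ofReal (1 / ((n : ℝ) + 1))}
    with hB
  have hanti : Antitone B := fun m n hmn x hx =>
    (fiberOsc_mono g s₀ (Nat.cast_le.2 hmn) x).trans (hx.trans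
      (ENNReal.ofReal_le_ofReal (Nat.one_div_le_one_div hmn)))
  have hBm : ∀ n, MeasurableSet (B n) := fun n =>
    measurableSet_le (measurable_fiberOsc hg s₀ n) measurable_const
  have hlim := tendsto_measure_iInter_atTop (μ := leb01) (fun n => (hBm n).nullMeasurableSet) hanti
    ⟨0, measure_ne_top _ _⟩
  have hge : ENNReal.ofReal c ≤ leb01 (⋂ n, B n) :=
    ge_of_tendsto' hlim fun n => hsmall g hg hg1 hinv n n.cast_nonneg _ (by positivity)
  refine ne_of_gt (lt_of_lt_of_le (ENNReal.ofReal_pos.2 hc) (hge.trans (measure_mono ?_)))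
  intro x hx
  have hzero : ∀ n : ℕ, fiberOsc g s₀ n x = 0 := by
    intro n
    have ht : Filter.Tendsto (fun m : ℕ => ENNReal.ofReal (1 / ((m : ℝ) + 1))) Filter.atTop
        (nhds 0) := by
      simpa using ENNReal.tendsto_ofReal tendsto_one_div_add_atTop_nhds_zero_nat
    refine le_antisymm (ge_of_tendsto ht ?_) zero_le
    filter_upwards [Filter.eventually_ge_atTop n] with m hm
    exact (fiberOsc_mono g s₀ (Nat.cast_le.2 hm) x).trans (mem_iInter.1 hx m)
  have h1 : ∀ n : ℕ, ∀ᵐ s ∂(volume.restrict (Ioo 0 s₀)),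
      ∀ᵐ r ∂(volume.restrict (Icc (-n : ℝ) n)), g (x, r + s) = g (x, r) := by
    intro n
    have := hzero n
    rw [fiberOsc, lintegral_eq_zero_iff (Measurable.lintegral_prod_right (by fun_prop))] at this
    filter_upwards [this] with s hs
    rw [Pi.zero_apply, lintegral_eq_zero_iff (by fun_prop)] at hs
    filter_upwards [hs] with r hr
    exact edist_eq_zero.1 hr
  filter_upwards [ae_all_iff.2 h1] with s hs
  have hU : ⋃ n : ℕ, Icc (-n : ℝ) n = univ := by
    refine eq_univ_of_forall fun r => ?_
    obtain ⟨n, hn⟩ := exists_nat_ge |r|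
    exact mem_iUnion.2 ⟨n, abs_le.1 hn⟩
  rw [← Measure.restrict_univ (μ := volume), ← hU, ae_restrict_iUnion_iff]
  exact hs

theorem ergodic_skewProduct (hT : SymmIET T P) {a : ℝ} (ha : a ≠ 0) :
    Ergodic (fun p : ℝ × ℝ => (T p.1, p.2 + a * (p.1 - 1 / 2)))
      (leb01.prod (volume : Measure ℝ)) := by
  have hmp : MeasurePreserving (fun p : ℝ × ℝ => (T p.1, p.2 + a * (p.1 - 1 / 2)))
      (leb01.prod (volume : Measure ℝ)) (leb01.prod volume) :=
    hT.measurePreserving.skew_product (g := fun x r => r + a * (x - 1 / 2)) (by fun_prop)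
      (ae_of_all _ fun x => map_add_right_eq_self volume (a * (x - 1 / 2)))
  refine ⟨hmp, ⟨fun A hA hAinv => ?_⟩⟩
  have hiff : ∀ x r, (T x, r + a * (x - 1 / 2)) ∈ A ↔ (x, r) ∈ A := fun x r =>
    Set.ext_iff.1 hAinv (x, r)
  obtain ⟨s₀, hs₀, hpos⟩ := hT.exists_fiber_translates ha
  have hg := hpos (A.indicator 1) (measurable_one.indicator hA)
    (fun p => by by_cases hp : p ∈ A <;> simp [hp])
    (fun x r => by simp only [indicator, hiff, Pi.one_apply])
  have hnull : ∀ S : Set (ℝ × ℝ), MeasurableSet S →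
      (∀ x r, (T x, r + a * (x - 1 / 2)) ∈ S ↔ (x, r) ∈ S) →
      leb01 {x | volume (Prod.mk x ⁻¹' S) = 0} ≠ 0 → (leb01.prod volume) S = 0 := by
    intro S hS hSinv hne
    have hm : MeasurableSet {x | volume (Prod.mk x ⁻¹' S) = 0} :=
      measurable_measure_prodMk_left hS (measurableSet_singleton 0)
    have hpre : T ⁻¹' {x | volume (Prod.mk x ⁻¹' S) = 0} = {x | volume (Prod.mk x ⁻¹' S) = 0} := by
      ext x
      change volume (Prod.mk (T x) ⁻¹' S) = 0 ↔ volume (Prod.mk x ⁻¹' S) = 0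
      rw [← measure_preimage_add_right volume (a * (x - 1 / 2)) (Prod.mk (T x) ⁻¹' S)]
      have : (fun r => r + a * (x - 1 / 2)) ⁻¹' (Prod.mk (T x) ⁻¹' S) = Prod.mk x ⁻¹' S := by
        ext r; exact hSinv x r
      rw [this]
    rw [Measure.measure_prod_null hS]
    rcases hT.erg.toPreErgodic.ae_empty_or_univ hm hpre with h | h
    · exact absurd (ae_eq_empty.1 h) hne
    · filter_upwards [Filter.eventuallyEq_univ.1 h] with x hx using hx
  have hsub : {x | ∀ᵐ s ∂(volume.restrict (Ioo 0 s₀)), ∀ᵐ r,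
      A.indicator (1 : ℝ × ℝ → ℝ) (x, r + s) = A.indicator 1 (x, r)} ⊆
      {x | volume (Prod.mk x ⁻¹' A) = 0} ∪ {x | volume (Prod.mk x ⁻¹' Aᶜ) = 0} := by
    intro x hx
    refine null_or_conull_of_ae_translate (measurable_prodMk_left hA) hs₀ ?_
    filter_upwards [hx] with s hs
    filter_upwards [hs] with r hr
    simp only [mem_preimage]
    by_cases h1 : (x, r + s) ∈ A <;> by_cases h2 : (x, r) ∈ A <;> simp_all
  rw [Filter.eventuallyConst_set']
  by_cases h0 : leb01 {x | volume (Prod.mk x ⁻¹' A) = 0} = 0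
  · right
    refine ae_eq_univ.2 (hnull Aᶜ hA.compl (fun x r => not_congr (hiff x r)) fun h1 => hg ?_)
    exact measure_mono_null hsub (measure_union_null h0 h1)
  · exact Or.inl (ae_eq_empty.2 (hnull A hA hiff h0))

end SymmIET

open IET

/-- ergodicity of the skew product over an ergodic symmetric IET of `[0,1)`
with cocycle `f(x) = a (x - 1/2)`, `a ≠ 0`. -/
theorem stmt0 (T : IET) (ha0 : T.a = 0) (hb1 : T.b = 1) (hsymm : T.IsSymm)
    (hErg : Ergodic T.toFun (volume.restrict (Set.Ico (0:ℝ) 1)))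
    (a : ℝ) (ha : a ≠ 0) :
    Ergodic (fun p : ℝ × ℝ => (T.toFun p.1, p.2 + a * (p.1 - 1/2)))
      ((volume.restrict (Set.Ico (0:ℝ) 1)).prod (volume : Measure ℝ)) := by
  exact (T.symmIET ha0 hb1 hsymm hErg).ergodic_skewProduct ha
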